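/- Every 1-planar graph with minimum degree 7 contains a copy of K₁ ∨ (K₁ ∪ K₂) (the 'paw' graph: a triangle with a pendant edge attached) all of whose vertices have degree at most 9 in G. -/

import Mathlib

/-- A 1-planar drawing of a simple graph in the plane: vertices at distinct
points, each edge an injective continuous arc between the images of its
endpoints, arc interiors avoiding vertices, any two arcs crossing in at most
one interior point, and every edge crossing at most one other edge. -/
structure OnePlanarDrawing {V : Type*} (G : SimpleGraph V) where
  pos : V → ℝ × ℝ
  pos_inj : Function.Injective pos
  arc : G.edgeSet → ℝ → ℝ × ℝ
  arc_cont : ∀ e, ContinuousOn (arc e) (Set.Icc 0 1)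
  arc_inj : ∀ e, Set.InjOn (arc e) (Set.Icc 0 1)
  arc_ends : ∀ e : G.edgeSet, ∃ u v : V, (e : Sym2 V) = s(u, v) ∧
      arc e 0 = pos u ∧ arc e 1 = pos v
  arc_avoids : ∀ e, ∀ t ∈ Set.Ioo (0 : ℝ) 1, arc e t ∉ Set.range pos
  crossings_subsingleton : ∀ e f : G.edgeSet, e ≠ f →
      (arc e '' Set.Ioo 0 1 ∩ arc f '' Set.Ioo 0 1).Subsingleton
  at_most_one_crossing : ∀ e : G.edgeSet,
      {f : G.edgeSet | f ≠ e ∧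
        (arc e '' Set.Ioo 0 1 ∩ arc f '' Set.Ioo 0 1).Nonempty}.Subsingleton

/-- A graph is 1-planar if it admits a drawing in the plane in which every
edge crosses at most one other edge. -/
def SimpleGraph.IsOnePlanar {V : Type*} (G : SimpleGraph V) : Prop :=
  Nonempty (OnePlanarDrawing G)

/-- Adjacency in the square grid `ℤ × ℤ`. -/
def gridAdj (s t : ℤ × ℤ) : Prop :=
  (s.1 = t.1 ∧ (s.2 = t.2 + 1 ∨ t.2 = s.2 + 1)) ∨ (s.2 = t.2 ∧ (s.1 = t.1 + 1 ∨ t.1 = s.1 + 1))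

instance (s t : ℤ × ℤ) : Decidable (gridAdj s t) := by unfold gridAdj; infer_instance

theorem gridAdj.symm {s t : ℤ × ℤ} (h : gridAdj s t) : gridAdj t s := by
  unfold gridAdj at *; omega

theorem gridAdj_comm {s t : ℤ × ℤ} : gridAdj s t ↔ gridAdj t s :=
  ⟨gridAdj.symm, gridAdj.symm⟩

/-- The vertices of the square grid in `[-n, n]²`. -/
noncomputable def gridBox (n : ℕ) : Finset (ℤ × ℤ) := Finset.Icc (-n : ℤ) n ×ˢ Finset.Icc (-n : ℤ) n

/-- The unit squares of the grid in `[-n, n]²`, named by their lower left corners. -/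
noncomputable def gridSquares (n : ℕ) : Finset (ℤ × ℤ) := Finset.Ico (-n : ℤ) n ×ˢ Finset.Ico (-n : ℤ) n

/-- The edges of the grid in `[-n, n]²`, horizontal and vertical, named by their lower left
endpoints. -/
noncomputable def gridEdges (n : ℕ) : Finset ((ℤ × ℤ) ⊕ (ℤ × ℤ)) :=
  (Finset.Ico (-n : ℤ) n ×ˢ Finset.Icc (-n : ℤ) n).disjSum
    (Finset.Icc (-n : ℤ) n ×ˢ Finset.Ico (-n : ℤ) n)

theorem mem_gridBox {n : ℕ} {s : ℤ × ℤ} :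
    s ∈ gridBox n ↔ (-n ≤ s.1 ∧ s.1 ≤ n) ∧ (-n ≤ s.2 ∧ s.2 ≤ n) := by
  simp [gridBox]

theorem mem_gridSquares {n : ℕ} {s : ℤ × ℤ} :
    s ∈ gridSquares n ↔ (-n ≤ s.1 ∧ s.1 < n) ∧ (-n ≤ s.2 ∧ s.2 < n) := by
  simp [gridSquares]

theorem grid_euler (n : ℕ) :
    (gridSquares n).card + (gridBox n).card = (gridEdges n).card + 1 := by
  simp only [gridSquares, gridBox, gridEdges, Finset.card_disjSum, Finset.card_product,
    Int.card_Icc, Int.card_Ico]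
  have h1 : ((n : ℤ) + 1 - -n).toNat = 2 * n + 1 := by omega
  have h2 : ((n : ℤ) - -n).toNat = 2 * n := by omega
  rw [h1, h2]; ring

/-- The name of the edge joining two adjacent grid vertices. -/
def edgeName (s t : ℤ × ℤ) : (ℤ × ℤ) ⊕ (ℤ × ℤ) :=
  if s.1 = t.1 then .inr (min s.1 t.1, min s.2 t.2) else .inl (min s.1 t.1, min s.2 t.2)

theorem edgeName_comm (s t : ℤ × ℤ) : edgeName s t = edgeName t s := by
  unfold edgeName; simp only [eq_comm, min_comm]

theorem edgeName_inj {s t s' t' : ℤ × ℤ} (h : gridAdj s t) (h' : gridAdj s' t')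
    (he : edgeName s t = edgeName s' t') : (s = s' ∧ t = t') ∨ (s = t' ∧ t = s') := by
  simp only [edgeName, Prod.ext_iff] at *
  unfold gridAdj at *
  split_ifs at he <;> simp at he <;> omega

theorem edgeName_mem {n : ℕ} {s t : ℤ × ℤ} (hs : s ∈ gridBox n) (ht : t ∈ gridBox n)
    (h : gridAdj s t) : edgeName s t ∈ gridEdges n := by
  rw [mem_gridBox] at hs ht
  unfold gridAdj at h
  unfold edgeName gridEdges
  split_ifs <;> simp <;> omega

/-- One of the two unit squares on an edge. -/
def sideA : (ℤ × ℤ) ⊕ (ℤ × ℤ) → ℤ × ℤ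
  | .inl p => p
  | .inr p => p

/-- The other unit square on an edge. -/
def sideB : (ℤ × ℤ) ⊕ (ℤ × ℤ) → ℤ × ℤ
  | .inl p => (p.1, p.2 - 1)
  | .inr p => (p.1 - 1, p.2)

/-- The boundary modulo two of a set of unit squares, as a function on pairs of vertices. -/
def gridBd (z : ℤ × ℤ → ZMod 2) (s t : ℤ × ℤ) : ZMod 2 :=
  if gridAdj s t then z (sideA (edgeName s t)) + z (sideB (edgeName s t)) else 0

theorem gridBd_comm (z : ℤ × ℤ → ZMod 2) (s t : ℤ × ℤ) : gridBd z s t = gridBd z t s := by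
  unfold gridBd; rw [edgeName_comm s t]; simp only [gridAdj_comm (s := s)]

theorem gridBd_adj {z : ℤ × ℤ → ZMod 2} {s t : ℤ × ℤ} (h : gridBd z s t ≠ 0) : gridAdj s t := by
  by_contra hc; exact h (if_neg hc)

theorem gridBd_add (z z' : ℤ × ℤ → ZMod 2) (s t : ℤ × ℤ) :
    gridBd (z + z') s t = gridBd z s t + gridBd z' s t := by
  unfold gridBd; split_ifs <;> simp; ring

theorem gridBd_mem {n : ℕ} {z : ℤ × ℤ → ZMod 2} (hz : ∀ q, q ∉ gridSquares n → z q = 0)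
    {s t : ℤ × ℤ} (h : gridBd z s t ≠ 0) : s ∈ gridBox n := by
  have ha := gridBd_adj h
  by_contra hs
  apply h
  rw [gridBd, if_pos ha]
  unfold gridAdj at ha
  rw [mem_gridBox] at hs
  rw [hz, hz, add_zero] <;> rw [mem_gridSquares] <;> unfold edgeName <;>
    split_ifs <;> simp only [sideA, sideB] <;> omega

theorem sum_gridBd {n : ℕ} {z : ℤ × ℤ → ZMod 2} (hz : ∀ q, q ∉ gridSquares n → z q = 0)
    (s : ℤ × ℤ) : ∑ t ∈ gridBox n, gridBd z s t = 0 := by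
  obtain ⟨x, y⟩ := s
  let F : Finset (ℤ × ℤ) := {(x + 1, y), (x - 1, y), (x, y + 1), (x, y - 1)}
  have h1 : ∑ t ∈ gridBox n, gridBd z (x, y) t = ∑ t ∈ gridBox n ∪ F, gridBd z (x, y) t := by
    refine Finset.sum_subset Finset.subset_union_left fun t _ ht => ?_
    by_contra h
    rw [gridBd_comm] at h
    exact ht (gridBd_mem hz h)
  have h2 : ∑ t ∈ F, gridBd z (x, y) t = ∑ t ∈ gridBox n ∪ F, gridBd z (x, y) t := by
    refine Finset.sum_subset Finset.subset_union_right fun t _ ht => ?_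
    by_contra h
    have := gridBd_adj h
    apply ht
    simp only [F, Finset.mem_insert, Finset.mem_singleton, Prod.ext_iff]
    unfold gridAdj at this
    simp only at this ⊢
    omega
  rw [h1, ← h2]
  have e1 : gridBd z (x, y) (x + 1, y) = z (x, y) + z (x, y - 1) := by
    simp [gridBd, gridAdj, edgeName, sideA, sideB]
  have e2 : gridBd z (x, y) (x - 1, y) = z (x - 1, y) + z (x - 1, y - 1) := by
    have : x ≠ x - 1 := by omega
    simp [this, gridBd, gridAdj, edgeName, sideA, sideB]
  have e3 : gridBd z (x, y) (x, y + 1) = z (x, y) + z (x - 1, y) := by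
    simp [gridBd, gridAdj, edgeName, sideA, sideB]
  have e4 : gridBd z (x, y) (x, y - 1) = z (x, y - 1) + z (x - 1, y - 1) := by
    simp [gridBd, gridAdj, edgeName, sideA, sideB]
  have hF : ∑ t ∈ F, gridBd z (x, y) t = gridBd z (x, y) (x + 1, y) + (gridBd z (x, y) (x - 1, y) +
      (gridBd z (x, y) (x, y + 1) + gridBd z (x, y) (x, y - 1))) := by
    rw [Finset.sum_insert, Finset.sum_insert, Finset.sum_insert, Finset.sum_singleton] <;>
      simp <;> omega
  rw [hF, e1, e2, e3, e4]
  generalize z (x, y) = a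
  generalize z (x, y - 1) = b
  generalize z (x - 1, y) = c
  generalize z (x - 1, y - 1) = d
  revert a b c d; decide

theorem eq_zero_of_gridBd_eq_zero {n : ℕ} {z : ℤ × ℤ → ZMod 2}
    (hz : ∀ q, q ∉ gridSquares n → z q = 0) (h : ∀ s t, gridBd z s t = 0) : z = 0 := by
  have step : ∀ x y : ℤ, z (x, y) = z (x - 1, y) := by
    intro x y
    have := h (x, y) (x, y + 1)
    simp [gridBd, gridAdj, edgeName, sideA, sideB] at this
    revert this
    generalize z (x, y) = a
    generalize z (x - 1, y) = b
    revert a b; decide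
  have steps : ∀ (k : ℕ) (x y : ℤ), z (x, y) = z (x - k, y) := by
    intro k
    induction k with
    | zero => simp
    | succ k ih =>
      intro x y
      rw [ih, step]
      push_cast
      congr 2; ring
  funext ⟨x, y⟩
  rw [steps (x + n + 1).toNat x y]
  apply hz
  rw [mem_gridSquares]
  simp only
  omega

/-- Identifying the ends of `D.card` pairs lowers the number of elements by at most `D.card`. -/
theorem exists_identification {α ι : Type*} [DecidableEq α] [DecidableEq ι] (nodes : Finset α)
    (D : Finset ι) (f g : ι → α) :
    ∃ c : α → α, (∀ i ∈ D, c (f i) = c (g i)) ∧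
      nodes.card ≤ (nodes.image c).card + D.card := by
  induction D using Finset.induction_on with
  | empty => exact ⟨id, by simp, by simp⟩
  | insert j D hj ih =>
    obtain ⟨c, hc, hcard⟩ := ih
    refine ⟨fun x => if c x = c (f j) then c (g j) else c x, ?_, ?_⟩
    · intro i hi
      rcases Finset.mem_insert.1 hi with rfl | hi
      · simp
      · simp only [hc i hi]
    · have hsub : (nodes.image c).erase (c (f j)) ⊆
          nodes.image (fun x => if c x = c (f j) then c (g j) else c x) := by
        intro y hy
        rw [Finset.mem_erase, Finset.mem_image] at hy
        obtain ⟨hy, x, hx, rfl⟩ := hy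
        exact Finset.mem_image.2 ⟨x, hx, if_neg hy⟩
      have h1 := Finset.card_le_card hsub
      have h2 := Finset.pred_card_le_card_erase (s := nodes.image c) (a := c (f j))
      rw [Finset.card_insert_of_notMem hj]
      omega

/-- A model of a graph as a minor of a square grid: the grid is split into connected fibres, each
of them a rooted tree whose edges lower the height, and adjacent vertices have adjacent fibres. -/
structure GridModel {N : Type*} (P : SimpleGraph N) where
  n : ℕ
  fib : ℤ × ℤ → N
  height : ℤ × ℤ → ℕ
  root : N → ℤ × ℤ
  root_mem : ∀ p, root p ∈ gridBox n
  fib_root : ∀ p, fib (root p) = p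
  parent : ∀ s ∈ gridBox n, s ≠ root (fib s) →
    ∃ t ∈ gridBox n, gridAdj s t ∧ fib t = fib s ∧ height t < height s
  edge : ∀ u v, P.Adj u v → ∃ s ∈ gridBox n, ∃ t ∈ gridBox n,
    gridAdj s t ∧ fib s = u ∧ fib t = v

/-- An element of the cycle space of a graph modulo two, as a function on pairs of vertices. -/
structure IsCycleFun {N : Type*} [Fintype N] (P : SimpleGraph N) (w : N → N → ZMod 2) : Prop where
  symm : ∀ u v, w u v = w v u
  diag : ∀ u, w u u = 0
  sum : ∀ u, ∑ v, w u v = 0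
  adj : ∀ u v, w u v ≠ 0 → P.Adj u v

theorem sum_symm_eq_zero {α : Type*} [DecidableEq α] (F : Finset α) (b : α → α → ZMod 2)
    (hs : ∀ s t, b s t = b t s) (hd : ∀ s, b s s = 0) : ∑ s ∈ F, ∑ t ∈ F, b s t = 0 := by
  rw [← Finset.sum_product']
  refine Finset.sum_involution (fun p _ => (p.2, p.1)) ?_ ?_ ?_ ?_
  · rintro ⟨s, t⟩ -
    simp only [hs t s]
    generalize b s t = a
    revert a; decide
  · rintro ⟨s, t⟩ - h he
    simp only [Prod.mk.injEq] at he
    rw [he.1] at h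
    exact h (hd s)
  · rintro ⟨s, t⟩ h
    simp only [Finset.mem_product] at h ⊢
    exact h.symm
  · rintro ⟨s, t⟩ _
    rfl

/-- The projection of the boundary of a set of unit squares to the vertices of the model. -/
noncomputable def projBd {N : Type*} [DecidableEq N] (n : ℕ) (fib : ℤ × ℤ → N)
    (z : ℤ × ℤ → ZMod 2) (u v : N) : ZMod 2 :=
  if u = v then 0 else
    ∑ s ∈ gridBox n with fib s = u, ∑ t ∈ gridBox n with fib t = v, gridBd z s t

theorem projBd_add {N : Type*} [DecidableEq N] (n : ℕ) (fib : ℤ × ℤ → N)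
    (z z' : ℤ × ℤ → ZMod 2) :
    projBd n fib (z + z') = projBd n fib z + projBd n fib z' := by
  funext u v
  simp only [projBd, Pi.add_apply]
  split_ifs
  · simp
  · simp only [gridBd_add, Finset.sum_add_distrib]

theorem projBd_symm {N : Type*} [DecidableEq N] (n : ℕ) (fib : ℤ × ℤ → N)
    (z : ℤ × ℤ → ZMod 2) (u v : N) : projBd n fib z u v = projBd n fib z v u := by
  unfold projBd
  by_cases h : u = v
  · simp [h]
  · rw [if_neg h, if_neg (Ne.symm h), Finset.sum_comm]
    simp only [gridBd_comm]

theorem sum_projBd {N : Type*} [Fintype N] [DecidableEq N] (n : ℕ) (fib : ℤ × ℤ → N)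
    (z : ℤ × ℤ → ZMod 2) (hz : ∀ q, q ∉ gridSquares n → z q = 0) (u : N) :
    ∑ v, projBd n fib z u v = 0 := by
  let b : N → ZMod 2 := fun v =>
    ∑ s ∈ gridBox n with fib s = u, ∑ t ∈ gridBox n with fib t = v, gridBd z s t
  have hb : b u = 0 := sum_symm_eq_zero _ _ (gridBd_comm z) fun s => by
    simp [gridBd, gridAdj]
  have h1 : ∀ v, projBd n fib z u v = b v := by
    intro v
    unfold projBd
    split_ifs with h
    · rw [← h, hb]
    · rfl
  simp only [h1, b]
  rw [Finset.sum_comm]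
  refine Finset.sum_eq_zero fun s _ => ?_
  rw [Finset.sum_fiberwise]
  exact sum_gridBd hz s

/-- A choice of parents and of edges of the grid representing the edges of the graph: the boundary
of a set of squares that uses only these edges is determined by its projection. -/
theorem GridModel.exists_kept {N : Type*} [Fintype N] [DecidableEq N] {P : SimpleGraph N}
    [DecidableRel P.Adj] (M : GridModel P) :
    ∃ K : Finset ((ℤ × ℤ) ⊕ (ℤ × ℤ)), K ⊆ gridEdges M.n ∧
      K.card + Fintype.card N = (gridBox M.n).card + P.edgeFinset.card ∧
      (∀ z : ℤ × ℤ → ZMod 2, (∀ q, q ∉ gridSquares M.n → z q = 0) →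
        (∀ s t, gridBd z s t ≠ 0 → edgeName s t ∈ K) →
        IsCycleFun P (projBd M.n M.fib z) ∧ (projBd M.n M.fib z = 0 → z = 0)) ∧
      ∀ u v, P.Adj u v → ∃ e, ∀ z : ℤ × ℤ → ZMod 2, (∀ q, q ∉ gridSquares M.n → z q = 0) →
        (∀ s t, gridBd z s t ≠ 0 → edgeName s t ∈ K) →
        projBd M.n M.fib z u v ≠ 0 → z (sideA e) + z (sideB e) ≠ 0 := by
  obtain ⟨n, fib, height, root, root_mem, fib_root, parent, edge⟩ := M
  simp only
  classical
  have hp : ∀ s, ∃ t, s ∈ gridBox n → s ≠ root (fib s) →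
      t ∈ gridBox n ∧ gridAdj s t ∧ fib t = fib s ∧ height t < height s := by
    intro s
    by_cases h : s ∈ gridBox n ∧ s ≠ root (fib s)
    · obtain ⟨t, h1, h2⟩ := parent s h.1 h.2
      exact ⟨t, fun _ _ => ⟨h1, h2⟩⟩
    · exact ⟨s, fun h1 h2 => absurd ⟨h1, h2⟩ h⟩
  choose par hpar using hp
  have he : ∀ k : Sym2 N, ∃ s t, k ∈ P.edgeFinset →
      s ∈ gridBox n ∧ t ∈ gridBox n ∧ gridAdj s t ∧ s(fib s, fib t) = k := by
    intro k
    by_cases h : k ∈ P.edgeFinset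
    · induction k with | _ u v
      obtain ⟨s, hs, t, ht, hst, rfl, rfl⟩ := edge u v (by simpa using h)
      exact ⟨s, t, fun _ => ⟨hs, ht, hst, rfl⟩⟩
    · exact ⟨(0, 0), (0, 0), fun h' => absurd h' h⟩
  choose es et hk using he
  have hne : ∀ k ∈ P.edgeFinset, fib (es k) ≠ fib (et k) := by
    intro k hk1 h
    have := (hk k hk1).2.2.2
    rw [← this, SimpleGraph.mem_edgeFinset, SimpleGraph.mem_edgeSet] at hk1
    exact hk1.ne h
  let I := (gridBox n).filter (fun s => s ≠ root (fib s))
  have hI : ∀ s ∈ I, par s ∈ gridBox n ∧ gridAdj s (par s) ∧ fib (par s) = fib s ∧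
      height (par s) < height s := fun s hs =>
    hpar s (Finset.mem_filter.1 hs).1 (Finset.mem_filter.1 hs).2
  let K₁ := I.image (fun s => edgeName s (par s))
  let K₂ := P.edgeFinset.image (fun k => edgeName (es k) (et k))
  have hK₁ : K₁.card + Fintype.card N = (gridBox n).card := by
    rw [Finset.card_image_of_injOn, ← Finset.card_filter_add_card_filter_not
      (s := gridBox n) (fun s => s ≠ root (fib s))]
    · congr 1
      have : (gridBox n).filter (fun s => ¬ s ≠ root (fib s)) = Finset.univ.image root := by
        ext s
        simp only [Finset.mem_filter, not_not, Finset.mem_image, Finset.mem_univ, true_and]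
        constructor
        · rintro ⟨-, h⟩
          exact ⟨_, h.symm⟩
        · rintro ⟨p, rfl⟩
          exact ⟨root_mem p, by rw [fib_root]⟩
      rw [this, Finset.card_image_of_injective _ (Function.LeftInverse.injective fib_root)]
      rfl
    · intro s hs t ht hst
      have h1 := hI s hs
      have h2 := hI t ht
      rcases edgeName_inj h1.2.1 h2.2.1 hst with h | h
      · exact h.1
      · have h3 := h1.2.2.2
        have h4 := h2.2.2.2
        rw [h.2] at h3
        rw [← h.1] at h4
        omega
  have hK₂ : K₂.card = P.edgeFinset.card := by
    apply Finset.card_image_of_injOn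
    intro k hk1 l hl1 hkl
    have h1 := hk k hk1
    have h2 := hk l hl1
    rw [← h1.2.2.2, ← h2.2.2.2]
    rcases edgeName_inj h1.2.2.1 h2.2.2.1 hkl with h | h
    · rw [h.1, h.2]
    · rw [h.1, h.2, Sym2.eq_swap]
  have hdisj : Disjoint K₁ K₂ := by
    rw [Finset.disjoint_left]
    intro e he1 he2
    obtain ⟨s, hs, rfl⟩ := Finset.mem_image.1 he1
    obtain ⟨k, hk1, hks⟩ := Finset.mem_image.1 he2
    have h1 := hI s hs
    have h2 := hk k hk1
    apply hne k hk1
    rcases edgeName_inj h2.2.2.1 h1.2.1 hks with h | h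
    · rw [h.1, h.2, h1.2.2.1]
    · rw [h.1, h.2, h1.2.2.1]
  have kept : ∀ s t, gridAdj s t → edgeName s t ∈ K₁ ∪ K₂ →
      (fib s = fib t ∧ ((s ∈ I ∧ t = par s) ∨ (t ∈ I ∧ s = par t))) ∨
      ∃ k ∈ P.edgeFinset, s(fib s, fib t) = k ∧
        ((s = es k ∧ t = et k) ∨ (s = et k ∧ t = es k)) := by
    intro s t hst hmem
    rcases Finset.mem_union.1 hmem with h | h
    · left
      obtain ⟨s', hs', h⟩ := Finset.mem_image.1 h
      have h1 := hI s' hs'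
      rcases edgeName_inj h1.2.1 hst h with ⟨rfl, rfl⟩ | ⟨rfl, rfl⟩
      · exact ⟨h1.2.2.1.symm, .inl ⟨hs', rfl⟩⟩
      · exact ⟨h1.2.2.1, .inr ⟨hs', rfl⟩⟩
    · right
      obtain ⟨k, hk1, h⟩ := Finset.mem_image.1 h
      have h1 := hk k hk1
      rcases edgeName_inj h1.2.2.1 hst h with ⟨rfl, rfl⟩ | ⟨rfl, rfl⟩
      · exact ⟨k, hk1, h1.2.2.2, .inl ⟨rfl, rfl⟩⟩
      · exact ⟨k, hk1, Sym2.eq_swap.trans h1.2.2.2, .inr ⟨rfl, rfl⟩⟩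
  have value : ∀ z : ℤ × ℤ → ZMod 2, (∀ s t, gridBd z s t ≠ 0 → edgeName s t ∈ K₁ ∪ K₂) →
      ∀ k ∈ P.edgeFinset,
        projBd n fib z (fib (es k)) (fib (et k)) = gridBd z (es k) (et k) := by
    intro z hzK k hk1
    have h1 := hk k hk1
    have key : ∀ s t, fib s = fib (es k) → fib t = fib (et k) → gridBd z s t ≠ 0 →
        s = es k ∧ t = et k := by
      intro s t hs ht h
      rcases kept s t (gridBd_adj h) (hzK s t h) with h2 | ⟨l, hl, h2, h3⟩
      · exact absurd (hs.symm.trans (h2.1.trans ht)) (hne k hk1)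
      · rw [hs, ht, h1.2.2.2] at h2
        subst h2
        rcases h3 with h3 | h3
        · exact h3
        · rw [h3.1] at hs
          exact absurd hs.symm (hne k hk1)
    rw [projBd, if_neg (hne k hk1), Finset.sum_eq_single (es k), Finset.sum_eq_single (et k)]
    · intro t ht h
      by_contra hc
      exact h (key _ _ rfl (Finset.mem_filter.1 ht).2 hc).2
    · intro h
      exact absurd (by simp [h1.2.1]) h
    · intro s hs h
      refine Finset.sum_eq_zero fun t ht => ?_
      by_contra hc
      exact h (key _ _ (Finset.mem_filter.1 hs).2 (Finset.mem_filter.1 ht).2 hc).1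
    · intro h
      exact absurd (by simp [h1.1]) h
  refine ⟨K₁ ∪ K₂, ?_, ?_, ?_, ?_⟩
  · apply Finset.union_subset
    · intro e he1
      obtain ⟨s, hs, rfl⟩ := Finset.mem_image.1 he1
      have h1 := hI s hs
      exact edgeName_mem (Finset.mem_filter.1 hs).1 h1.1 h1.2.1
    · intro e he1
      obtain ⟨k, hk1, rfl⟩ := Finset.mem_image.1 he1
      have h1 := hk k hk1
      exact edgeName_mem h1.1 h1.2.1 h1.2.2.1
  · rw [Finset.card_union_of_disjoint hdisj]
    omega
  · intro z hz hzK
    refine ⟨⟨projBd_symm n fib z, fun u => by simp [projBd], sum_projBd n fib z hz, ?_⟩, ?_⟩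
    · intro u v h
      have huv : u ≠ v := by
        rintro rfl
        exact h (by simp [projBd])
      rw [projBd, if_neg huv] at h
      obtain ⟨s, hs, h⟩ := Finset.exists_ne_zero_of_sum_ne_zero h
      obtain ⟨t, ht, h⟩ := Finset.exists_ne_zero_of_sum_ne_zero h
      have hs := (Finset.mem_filter.1 hs).2
      have ht := (Finset.mem_filter.1 ht).2
      rcases kept s t (gridBd_adj h) (hzK s t h) with h2 | ⟨k, hk1, h2, -⟩
      · exact absurd (hs.symm.trans (h2.1.trans ht)) huv
      · rw [hs, ht] at h2
        rw [← h2] at hk1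
        simpa using hk1
    · intro h0
      apply eq_zero_of_gridBd_eq_zero hz
      by_contra! hc
      have tree : ∀ s t, gridBd z s t ≠ 0 → (s ∈ I ∧ t = par s) ∨ (t ∈ I ∧ s = par t) := by
        intro s t h
        rcases kept s t (gridBd_adj h) (hzK s t h) with h2 | ⟨k, hk1, -, h2⟩
        · exact h2.2
        · have h3 := value z hzK k hk1
          rw [h0] at h3
          exfalso
          rcases h2 with ⟨rfl, rfl⟩ | ⟨rfl, rfl⟩
          · exact h h3.symm
          · exact h ((gridBd_comm _ _ _).trans h3.symm)
      let A := (gridBox n).filter (fun s => ∃ t, gridBd z s t ≠ 0)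
      have hA : A.Nonempty := by
        obtain ⟨s, t, h⟩ := hc
        exact ⟨s, Finset.mem_filter.2 ⟨gridBd_mem hz h, t, h⟩⟩
      obtain ⟨s, hs, hmax⟩ := A.exists_max_image height hA
      obtain ⟨hsb, t, hst⟩ := Finset.mem_filter.1 hs
      have up : ∀ t, gridBd z s t ≠ 0 → t = par s := by
        intro t ht
        rcases tree s t ht with h | h
        · exact h.2
        · have h1 := (hI t h.1).2.2.2
          rw [← h.2] at h1
          rw [gridBd_comm] at ht
          have h2 := hmax t (Finset.mem_filter.2 ⟨gridBd_mem hz ht, s, ht⟩)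
          omega
      have hsum := sum_gridBd hz s
      rw [Finset.sum_eq_single (par s)] at hsum
      · rw [up t hst] at hst
        exact hst hsum
      · intro t' _ h
        by_contra h'
        exact h (up t' h')
      · intro h
        rw [up t hst, gridBd_comm] at hst
        exact absurd (gridBd_mem hz hst) h
  · intro u v huv
    have hk1 : s(u, v) ∈ P.edgeFinset := by simpa using huv
    refine ⟨edgeName (es s(u, v)) (et s(u, v)), fun z hz hzK h => ?_⟩
    have h1 := value z hzK _ hk1
    have h2 := hk _ hk1
    rw [gridBd, if_pos h2.2.2.1] at h1
    rw [← h1]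
    rcases Sym2.eq_iff.1 h2.2.2.2 with h3 | h3
    · rwa [h3.1, h3.2]
    · rwa [h3.1, h3.2, projBd_symm]

/-- A graph that is a minor of a square grid has a large independent set of elements of its cycle
space such that every edge lies in at most two of them. -/
theorem GridModel.exists_cycleFuns {N : Type*} [Fintype N] [DecidableEq N] {P : SimpleGraph N}
    [DecidableRel P.Adj] (M : GridModel P) :
    ∃ (𝒞 : Finset (ℤ × ℤ)) (w : ℤ × ℤ → N → N → ZMod 2),
      (∀ C ∈ 𝒞, IsCycleFun P (w C) ∧ w C ≠ 0) ∧ Set.InjOn w 𝒞 ∧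
      (∀ u v, P.Adj u v → (𝒞.filter fun C => w C u v ≠ 0).card ≤ 2) ∧
      P.edgeFinset.card + 1 ≤ 𝒞.card + Fintype.card N := by
  obtain ⟨K, hK, hcard, hcyc, htwo⟩ := M.exists_kept
  set n := M.n
  let o : ℤ × ℤ := (n, n)
  have ho : o ∉ gridSquares n := by simp [o, mem_gridSquares]
  let cl : ℤ × ℤ → ℤ × ℤ := fun q => if q ∈ gridSquares n then q else o
  obtain ⟨c, hc, hcc⟩ := exists_identification (insert o (gridSquares n)) (gridEdges n \ K)
    (fun e => cl (sideA e)) (fun e => cl (sideB e))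
  let 𝒞 := ((insert o (gridSquares n)).image c).erase (c o)
  let z : ℤ × ℤ → ℤ × ℤ → ZMod 2 := fun C q => if c (cl q) = C then 1 else 0
  have hz : ∀ C ∈ 𝒞, ∀ q, q ∉ gridSquares n → z C q = 0 := by
    intro C hC q hq
    have : cl q = o := if_neg hq
    simp only [z, this]
    exact if_neg (Finset.ne_of_mem_erase hC).symm
  have hzK : ∀ C ∈ 𝒞, ∀ s t, gridBd (z C) s t ≠ 0 → edgeName s t ∈ K := by
    intro C hC s t h
    by_contra hn
    have hadj := gridBd_adj h
    have hs := gridBd_mem (hz C hC) h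
    rw [gridBd_comm] at h
    have ht := gridBd_mem (hz C hC) h
    rw [gridBd_comm] at h
    have := hc (edgeName s t) (Finset.mem_sdiff.2 ⟨edgeName_mem hs ht hadj, hn⟩)
    rw [gridBd, if_pos hadj] at h
    apply h
    simp only [z, this]
    split_ifs
    · decide
    · simp
  have hzne : ∀ C ∈ 𝒞, ∃ q, z C q = 1 ∧ ∀ C', z C' q = 1 → C' = C := by
    intro C hC
    obtain ⟨hC0, hC⟩ := Finset.mem_erase.1 hC
    obtain ⟨q, hq, rfl⟩ := Finset.mem_image.1 hC
    have hq : q ∈ gridSquares n := by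
      rcases Finset.mem_insert.1 hq with rfl | hq
      · exact absurd rfl hC0
      · exact hq
    have : cl q = q := if_pos hq
    refine ⟨q, by simp [z, this], fun C' h => ?_⟩
    by_contra hn
    simp [z, this, Ne.symm hn] at h
  refine ⟨𝒞, fun C => projBd n M.fib (z C), fun C hC => ?_, ?_, ?_, ?_⟩
  · obtain ⟨h1, h2⟩ := hcyc (z C) (hz C hC) (hzK C hC)
    refine ⟨h1, fun h0 => ?_⟩
    obtain ⟨q, hq, -⟩ := hzne C hC
    rw [h2 h0] at hq
    exact zero_ne_one hq
  · intro C hC C' hC' h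
    simp only at h
    obtain ⟨-, h2⟩ := hcyc (z C + z C')
      (fun q hq => by rw [Pi.add_apply, hz C hC q hq, hz C' hC' q hq, add_zero])
      (fun s t hst => by
        by_contra hn
        apply hst
        rw [gridBd_add]
        have h3 : gridBd (z C) s t = 0 := by
          by_contra h3
          exact hn (hzK C hC s t h3)
        have h4 : gridBd (z C') s t = 0 := by
          by_contra h4
          exact hn (hzK C' hC' s t h4)
        rw [h3, h4, add_zero])
    have h5 := h2 (by
      rw [projBd_add, h]
      funext u v
      simp only [Pi.add_apply, Pi.zero_apply]
      generalize projBd n M.fib (z C') u v = a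
      revert a; decide)
    obtain ⟨q, hq, hq'⟩ := hzne C hC
    have h6 := congrFun h5 q
    rw [Pi.add_apply, hq, Pi.zero_apply] at h6
    refine (hq' C' ?_).symm
    revert h6
    generalize z C' q = a
    revert a; decide
  · intro u v huv
    obtain ⟨e, he⟩ := htwo u v huv
    refine (Finset.card_le_card (t := {c (cl (sideA e)), c (cl (sideB e))}) ?_).trans
      Finset.card_le_two
    intro C hC
    obtain ⟨hC, hne⟩ := Finset.mem_filter.1 hC
    have := he (z C) (hz C hC) (hzK C hC) hne
    rw [Finset.mem_insert, Finset.mem_singleton]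
    by_contra! hn
    apply this
    simp [z, hn.1.symm, hn.2.symm]
  · have h1 := Finset.card_insert_of_notMem ho
    have h2 := Finset.pred_card_le_card_erase (s := (insert o (gridSquares n)).image c) (a := c o)
    have h3 := Finset.card_sdiff_add_card_eq_card hK
    have h4 := grid_euler n
    change _ ≤ 𝒞.card + _
    change _ ≤ 𝒞.card at h2
    omega

theorem IsCycleFun.eight_le {N : Type*} [Fintype N] [DecidableEq N] {P : SimpleGraph N}
    {w : N → N → ZMod 2} (hw : IsCycleFun P w) {a b c d e f g h : N}
    (h1 : w a b ≠ 0) (h2 : w c d ≠ 0) (h3 : w e f ≠ 0) (h4 : w g h ≠ 0)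
    (n1 : s(a, b) ≠ s(c, d)) (n2 : s(a, b) ≠ s(e, f)) (n3 : s(a, b) ≠ s(g, h))
    (n4 : s(c, d) ≠ s(e, f)) (n5 : s(c, d) ≠ s(g, h)) (n6 : s(e, f) ≠ s(g, h)) :
    8 ≤ (Finset.univ.filter fun p : N × N => w p.1 p.2 ≠ 0).card := by
  have ne : ∀ {u v}, w u v ≠ 0 → u ≠ v := fun h => (hw.adj _ _ h).ne
  have sw : ∀ {u v}, w u v ≠ 0 → w v u ≠ 0 := fun h => by rwa [hw.symm]
  have hsub : ({s(a, b), s(c, d), s(e, f), s(g, h)} : Finset (Sym2 N)).biUnion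
      (fun k => Finset.univ.filter fun p : N × N => s(p.1, p.2) = k) ⊆
      Finset.univ.filter fun p : N × N => w p.1 p.2 ≠ 0 := by
    intro p hp
    simp only [Finset.mem_biUnion, Finset.mem_filter, Finset.mem_univ, true_and,
      exists_eq_right', Finset.mem_insert, Finset.mem_singleton, Sym2.eq_iff] at hp ⊢
    rcases hp with (hp | hp) | (hp | hp) | (hp | hp) | (hp | hp) <;> rw [hp.1, hp.2]
    exacts [h1, sw h1, h2, sw h2, h3, sw h3, h4, sw h4]
  refine le_trans ?_ (Finset.card_le_card hsub)
  have two : ∀ u v, w u v ≠ 0 →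
      (Finset.univ.filter fun p : N × N => s(p.1, p.2) = s(u, v)).card = 2 := by
    intro u v huv
    refine Finset.card_eq_two.2 ⟨(u, v), (v, u), fun he => ne huv (Prod.ext_iff.1 he).1, ?_⟩
    ext p
    simp [Prod.ext_iff]
  rw [Finset.card_biUnion]
  · rw [Finset.sum_insert (by simp [n1, n2, n3]), Finset.sum_insert (by simp [n4, n5]),
      Finset.sum_insert (by simp [n6]), Finset.sum_singleton, two _ _ h1, two _ _ h2, two _ _ h3,
      two _ _ h4]
    norm_num
  · intro k _ l _ hkl
    refine Finset.disjoint_left.2 fun p hp hp' => ?_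
    exact hkl ((Finset.mem_filter.1 hp).2.symm.trans (Finset.mem_filter.1 hp').2)

/-- A nonzero element of the cycle space of a simple graph is a triangle or has at least four
edges. -/
theorem IsCycleFun.triangle_or {N : Type*} [Fintype N] [DecidableEq N] {P : SimpleGraph N}
    {w : N → N → ZMod 2} (hw : IsCycleFun P w) (h0 : w ≠ 0) :
    (∃ t : Finset N, t.card = 3 ∧ ∀ u v, w u v ≠ 0 ↔ u ≠ v ∧ u ∈ t ∧ v ∈ t) ∨
      8 ≤ (Finset.univ.filter fun p : N × N => w p.1 p.2 ≠ 0).card := by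
  have next : ∀ u v, w u v ≠ 0 → ∃ x, x ≠ v ∧ w u x ≠ 0 := by
    intro u v h
    by_contra! hc
    have := hw.sum u
    rw [Finset.sum_eq_single v (fun x _ hx => hc x hx) (by simp)] at this
    exact h this
  have ne : ∀ {u v}, w u v ≠ 0 → u ≠ v := fun h => (hw.adj _ _ h).ne
  have sw : ∀ {u v}, w u v ≠ 0 → w v u ≠ 0 := fun h => by rwa [hw.symm]
  obtain ⟨u, v, huv⟩ : ∃ u v, w u v ≠ 0 := by
    by_contra! hc
    exact h0 (funext fun u => funext fun v => hc u v)
  have four := fun a b c d e f g h h1 h2 h3 h4 n1 n2 n3 n4 n5 n6 =>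
    hw.eight_le (a := a) (b := b) (c := c) (d := d) (e := e) (f := f) (g := g) (h := h)
      h1 h2 h3 h4 n1 n2 n3 n4 n5 n6
  obtain ⟨y, hyu, hvy⟩ := next v u (sw huv)
  obtain ⟨x, hxv, hyx⟩ := next y v (sw hvy)
  have e1 := ne huv
  have e2 := ne hvy
  have e3 := ne hyx
  by_cases hxu : x = u
  · subst hxu
    by_cases hmore : ∃ p q, w p q ≠ 0 ∧ s(p, q) ≠ s(x, v) ∧ s(p, q) ≠ s(v, y) ∧ s(p, q) ≠ s(y, x)
    · obtain ⟨p, q, hpq, h1, h2, h3⟩ := hmore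
      right
      refine four p q x v v y y x hpq huv hvy hyx h1 h2 h3 ?_ ?_ ?_ <;>
        rw [ne_eq, Sym2.eq_iff] <;> grind
    · left
      push Not at hmore
      refine ⟨{x, v, y}, Finset.card_eq_three.2 ⟨x, v, y, e1, hyu.symm, e2, rfl⟩, fun p q => ?_⟩
      simp only [Finset.mem_insert, Finset.mem_singleton]
      constructor
      · intro h
        refine ⟨ne h, ?_⟩
        by_cases h1 : s(p, q) = s(x, v)
        · rw [Sym2.eq_iff] at h1
          grind
        by_cases h2 : s(p, q) = s(v, y)
        · rw [Sym2.eq_iff] at h2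
          grind
        · have h3 := hmore p q h h1 h2
          rw [Sym2.eq_iff] at h3
          grind
      · rintro ⟨hne, rfl | rfl | rfl, rfl | rfl | rfl⟩
        all_goals first | exact absurd rfl hne | assumption | (apply sw; assumption)
  · right
    obtain ⟨q, hqv, huq⟩ := next u v huv
    refine four u v v y y x u q huv hvy hyx huq ?_ ?_ ?_ ?_ ?_ ?_ <;>
      rw [ne_eq, Sym2.eq_iff] <;> grind

/-- A graph with a grid model has a family of triangles, at most two on each edge, that makes up
for the excess of the number of edges over twice the number of vertices. -/
theorem GridModel.exists_triangles {N : Type*} [Fintype N] [DecidableEq N] {P : SimpleGraph N}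
    [DecidableRel P.Adj] (M : GridModel P) :
    ∃ T : Finset (Finset N), (∀ t ∈ T, P.IsNClique 3 t) ∧
      (∀ u v, u ≠ v → (T.filter fun t => u ∈ t ∧ v ∈ t).card ≤ 2) ∧
      2 * P.edgeFinset.card + 4 ≤ 4 * Fintype.card N + T.card := by
  obtain ⟨𝒞, w, hw, hinj, htwo, hcard⟩ := M.exists_cycleFuns
  let A : ℤ × ℤ → Finset (N × N) := fun C => Finset.univ.filter fun p => w C p.1 p.2 ≠ 0
  let 𝒯 := 𝒞.filter fun C => (A C).card < 8
  have htri : ∀ C, ∃ t : Finset N, C ∈ 𝒯 →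
      t.card = 3 ∧ ∀ u v, w C u v ≠ 0 ↔ u ≠ v ∧ u ∈ t ∧ v ∈ t := by
    intro C
    by_cases hC : C ∈ 𝒯
    · obtain ⟨hC, hlt⟩ := Finset.mem_filter.1 hC
      rcases (hw C hC).1.triangle_or (hw C hC).2 with ⟨t, ht⟩ | h
      · exact ⟨t, fun _ => ht⟩
      · exact absurd h (not_le.2 hlt)
    · exact ⟨∅, fun h => absurd h hC⟩
  choose t ht using htri
  have hinjt : Set.InjOn t 𝒯 := by
    intro C hC C' hC' h
    apply hinj (Finset.mem_filter.1 hC).1 (Finset.mem_filter.1 hC').1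
    funext u v
    have h1 := (ht C hC).2 u v
    rw [h, ← (ht C' hC').2 u v] at h1
    revert h1
    generalize w C u v = a
    generalize w C' u v = b
    revert a b; decide
  have hsix : ∀ C ∈ 𝒯, 6 ≤ (A C).card := by
    intro C hC
    obtain ⟨h1, h2⟩ := ht C hC
    have h3 : A C = (t C).offDiag := by
      ext p
      simp only [A, Finset.mem_filter, Finset.mem_univ, true_and, h2, Finset.mem_offDiag]
      tauto
    rw [h3, Finset.offDiag_card, h1]
  have hdart : (Finset.univ.filter fun p : N × N => P.Adj p.1 p.2).card =
      2 * P.edgeFinset.card := by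
    rw [← P.sum_degrees_eq_twice_card_edges, Finset.card_filter, Fintype.sum_prod_type]
    refine Finset.sum_congr rfl fun u _ => ?_
    rw [← Finset.card_filter, ← P.card_neighborFinset_eq_degree, SimpleGraph.neighborFinset_eq_filter]
  have hsum : ∑ C ∈ 𝒞, (A C).card ≤ 2 * (2 * P.edgeFinset.card) := by
    have h1 : ∑ C ∈ 𝒞, (A C).card =
        ∑ p : N × N, (𝒞.filter fun C => w C p.1 p.2 ≠ 0).card := by
      simp only [A, Finset.card_filter]
      exact Finset.sum_comm
    rw [h1, ← hdart, mul_comm, Finset.card_filter, Finset.sum_mul]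
    refine Finset.sum_le_sum fun p _ => ?_
    split_ifs with h
    · simpa using htwo _ _ h
    · simp only [zero_mul, nonpos_iff_eq_zero, Finset.card_eq_zero, Finset.filter_eq_empty_iff,
        not_not]
      intro C hC
      by_contra hne
      exact h ((hw C hC).1.adj _ _ hne)
  have hlow : 8 * 𝒞.card ≤ ∑ C ∈ 𝒞, (A C).card + 2 * 𝒯.card := by
    rw [Finset.card_filter, Finset.mul_sum, ← Finset.sum_add_distrib, mul_comm, ← smul_eq_mul]
    refine Finset.card_nsmul_le_sum _ _ _ fun C hC => ?_
    split_ifs with h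
    · have := hsix C (Finset.mem_filter.2 ⟨hC, h⟩)
      omega
    · omega
  refine ⟨𝒯.image t, ?_, ?_, ?_⟩
  · intro s hs
    obtain ⟨C, hC, rfl⟩ := Finset.mem_image.1 hs
    obtain ⟨h1, h2⟩ := ht C hC
    refine ⟨fun u hu v hv huv => ?_, h1⟩
    exact (hw C (Finset.mem_filter.1 hC).1).1.adj _ _ ((h2 u v).2 ⟨huv, hu, hv⟩)
  · intro u v huv
    by_cases hadj : P.Adj u v
    · refine le_trans ?_ (htwo u v hadj)
      rw [Finset.filter_image]
      refine Finset.card_image_le.trans (Finset.card_le_card ?_)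
      intro C hC
      obtain ⟨hC, h⟩ := Finset.mem_filter.1 hC
      exact Finset.mem_filter.2 ⟨(Finset.mem_filter.1 hC).1, ((ht C hC).2 u v).2 ⟨huv, h⟩⟩
    · rw [Finset.card_eq_zero.2]
      · omega
      rw [Finset.filter_eq_empty_iff]
      intro s hs h
      obtain ⟨C, hC, rfl⟩ := Finset.mem_image.1 hs
      exact hadj ((hw C (Finset.mem_filter.1 hC).1).1.adj _ _ (((ht C hC).2 u v).2 ⟨huv, h⟩))
  · rw [Finset.card_image_of_injOn hinjt]
    omega

/-- Connectedness of a set of grid vertices. -/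
def GridPreconnected (Y : Finset (ℤ × ℤ)) : Prop :=
  ∀ A : ℤ × ℤ → Prop, (∃ s ∈ Y, A s) → (∃ s ∈ Y, ¬ A s) →
    ∃ s ∈ Y, ∃ t ∈ Y, A s ∧ ¬ A t ∧ gridAdj s t

/-- A rooted forest in the part `D` of the grid, with the given roots and fibres as trees. -/
structure IsGridForest {N : Type*} (n : ℕ) (root : N → ℤ × ℤ) (D : Finset (ℤ × ℤ))
    (fib : ℤ × ℤ → N) (height : ℤ × ℤ → ℕ) : Prop where
  subset : D ⊆ gridBox n
  root_mem : ∀ p, root p ∈ D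
  fib_root : ∀ p, fib (root p) = p
  parent : ∀ s ∈ D, s ≠ root (fib s) →
    ∃ t ∈ D, gridAdj s t ∧ fib t = fib s ∧ height t < height s

theorem IsGridForest.exists_grow {N : Type*} {n : ℕ} {root : N → ℤ × ℤ} (Y : Finset (ℤ × ℤ))
    (hYn : Y ⊆ gridBox n) (hY : GridPreconnected Y) (k : ℕ) :
    ∀ {D : Finset (ℤ × ℤ)} {fib : ℤ × ℤ → N} {height : ℤ × ℤ → ℕ}, (Y \ D).card = k →
    IsGridForest n root D fib height → (∃ s ∈ Y, s ∈ D) →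
    ∃ fib' height', IsGridForest n root (D ∪ Y) fib' height' ∧ (∀ s ∈ D, fib' s = fib s) ∧
      ∀ s ∈ Y, ∃ t ∈ Y, t ∈ D ∧ fib' s = fib t := by
  induction k with
  | zero =>
    intro D fib height hk hF _
    rw [Finset.card_eq_zero, Finset.sdiff_eq_empty_iff_subset] at hk
    rw [Finset.union_eq_left.2 hk]
    exact ⟨fib, height, hF, fun _ _ => rfl, fun s hs => ⟨s, hs, hk hs, rfl⟩⟩
  | succ k ih =>
    intro D fib height hk hF hYD
    have hpos : 0 < (Y \ D).card := by omega
    obtain ⟨t₀, ht₀⟩ := Finset.card_pos.1 hpos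
    rw [Finset.mem_sdiff] at ht₀
    obtain ⟨s, hs, t, ht, hsD, htD, hst⟩ := hY (· ∈ D) hYD ⟨t₀, ht₀⟩
    have key : ∀ x ∈ D, x ≠ t := fun x hx h => htD (h ▸ hx)
    have hF' : IsGridForest n root (insert t D) (Function.update fib t (fib s))
        (Function.update height t (height s + 1)) := by
      refine ⟨Finset.insert_subset (hYn ht) hF.subset,
        fun p => Finset.mem_insert_of_mem (hF.root_mem p), fun p => ?_, fun x hx hxr => ?_⟩
      · rw [Function.update_of_ne (key _ (hF.root_mem p)), hF.fib_root]
      · rcases Finset.mem_insert.1 hx with rfl | hx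
        · refine ⟨s, Finset.mem_insert_of_mem hsD, hst.symm, ?_, ?_⟩
          · rw [Function.update_self, Function.update_of_ne (key s hsD)]
          · rw [Function.update_self, Function.update_of_ne (key s hsD)]
            omega
        · rw [Function.update_of_ne (key x hx)] at hxr
          obtain ⟨y, hy, h1, h2, h3⟩ := hF.parent x hx hxr
          refine ⟨y, Finset.mem_insert_of_mem hy, h1, ?_, ?_⟩ <;>
            rw [Function.update_of_ne (key y hy), Function.update_of_ne (key x hx)] <;> assumption
    have hk' : (Y \ insert t D).card = k := by
      rw [Finset.sdiff_insert, Finset.card_erase_of_mem (Finset.mem_sdiff.2 ⟨ht, htD⟩)]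
      omega
    obtain ⟨fib', height', h1, h2, h3⟩ := ih hk' hF' ⟨s, hs, Finset.mem_insert_of_mem hsD⟩
    have hun : insert t D ∪ Y = D ∪ Y := by
      rw [Finset.insert_union, Finset.insert_eq_of_mem (Finset.mem_union_right _ ht)]
    rw [hun] at h1
    refine ⟨fib', height', h1, fun x hx => ?_, fun x hx => ?_⟩
    · rw [h2 x (Finset.mem_insert_of_mem hx), Function.update_of_ne (key x hx)]
    · obtain ⟨y, hy, hyD, hxy⟩ := h3 x hx
      rcases Finset.mem_insert.1 hyD with rfl | hyD
      · exact ⟨s, hs, hsD, by rw [hxy, Function.update_self]⟩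
      · exact ⟨y, hy, hyD, by rw [hxy, Function.update_of_ne (key y hyD)]⟩

theorem IsGridForest.exists_grow_family {N ι : Type*} [DecidableEq ι] {n : ℕ} {root : N → ℤ × ℤ}
    (Y : ι → Finset (ℤ × ℤ)) (hYn : ∀ i, Y i ⊆ gridBox n) (hY : ∀ i, GridPreconnected (Y i))
    (hdisj : ∀ i j, i ≠ j → Disjoint (Y i) (Y j))
    {D : Finset (ℤ × ℤ)} {fib : ℤ × ℤ → N} {height : ℤ × ℤ → ℕ}
    (hF : IsGridForest n root D fib height) (hYD : ∀ i, ∃ s ∈ Y i, s ∈ D) (J : Finset ι) :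
    ∃ fib' height', IsGridForest n root (D ∪ J.biUnion Y) fib' height' ∧
      (∀ s ∈ D, fib' s = fib s) ∧ ∀ i ∈ J, ∀ s ∈ Y i, ∃ t ∈ Y i, t ∈ D ∧ fib' s = fib t := by
  induction J using Finset.induction_on with
  | empty => exact ⟨fib, height, by simpa using hF, fun _ _ => rfl, by simp⟩
  | insert j J hj ih =>
    obtain ⟨fib₁, height₁, hF₁, h1, h2⟩ := ih
    obtain ⟨fib₂, height₂, hF₂, h3, h4⟩ := hF₁.exists_grow (Y j) (hYn j) (hY j) _ rfl
      (by obtain ⟨s, hs, hsD⟩ := hYD j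
          exact ⟨s, hs, Finset.mem_union_left _ hsD⟩)
    refine ⟨fib₂, height₂, ?_, ?_, ?_⟩
    · rwa [Finset.biUnion_insert, Finset.union_left_comm, Finset.union_comm]
    · intro s hs
      rw [h3 s (Finset.mem_union_left _ hs), h1 s hs]
    · intro i hi s hs
      rcases Finset.mem_insert.1 hi with rfl | hi
      · obtain ⟨t, ht, htD, hst⟩ := h4 s hs
        rcases Finset.mem_union.1 htD with htD | htD
        · exact ⟨t, ht, htD, by rw [hst, h1 t htD]⟩
        · obtain ⟨i', hi', ht'⟩ := Finset.mem_biUnion.1 htD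
          have hne : i ≠ i' := fun h => hj (h ▸ hi')
          exact absurd ht' (Finset.disjoint_left.1 (hdisj _ _ hne) ht)
      · obtain ⟨t, ht, htD, hst⟩ := h2 i hi s hs
        refine ⟨t, ht, htD, ?_⟩
        rw [h3 s (Finset.mem_union_right _ (Finset.mem_biUnion.2 ⟨i, hi, hs⟩)), hst]

/-- A predicate that does not change along grid edges is constant on a product of intervals. -/
theorem gridPreconnected_aux (I J : Set ℤ) (hI : I.OrdConnected) (hJ : J.OrdConnected)
    (A : ℤ × ℤ → Prop)
    (hA : ∀ s t : ℤ × ℤ, s.1 ∈ I → s.2 ∈ J → t.1 ∈ I → t.2 ∈ J → gridAdj s t → (A s ↔ A t)) :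
    ∀ s t : ℤ × ℤ, s.1 ∈ I → s.2 ∈ J → t.1 ∈ I → t.2 ∈ J → A s → A t := by
  have line : ∀ (K : Set ℤ) (_ : K.OrdConnected) (B : ℤ → Prop)
      (_ : ∀ k, k ∈ K → k + 1 ∈ K → (B k ↔ B (k + 1))) (m : ℕ) (a : ℤ), a ∈ K → a + m ∈ K →
      (B a ↔ B (a + m)) := by
    intro K hK B hB m
    induction m with
    | zero => simp
    | succ m ih =>
      intro a ha ham
      have h1 : a + m ∈ K := hK.out ha ham ⟨by omega, by push_cast; omega⟩
      rw [ih a ha h1, hB _ h1 (by push_cast at ham; convert ham using 1; ring)]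
      push_cast
      rw [add_assoc]
  have line' : ∀ (K : Set ℤ) (_ : K.OrdConnected) (B : ℤ → Prop)
      (_ : ∀ k, k ∈ K → k + 1 ∈ K → (B k ↔ B (k + 1))) (a b : ℤ), a ∈ K → b ∈ K →
      (B a ↔ B b) := by
    intro K hK B hB a b ha hb
    rcases le_total a b with h | h
    · have := line K hK B hB (b - a).toNat a ha
      rw [show a + ((b - a).toNat : ℤ) = b by omega] at this
      exact this hb
    · have := line K hK B hB (a - b).toNat b hb
      rw [show b + ((a - b).toNat : ℤ) = a by omega] at this
      exact (this ha).symm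
  rintro ⟨x, y⟩ ⟨x', y'⟩ hx hy hx' hy' h
  have h1 := line' I hI (fun k => A (k, y)) (fun k hk hk' => hA _ _ hk hy hk' hy (by
    unfold gridAdj; simp)) x x' hx hx'
  have h2 := line' J hJ (fun k => A (x', k)) (fun k hk hk' => hA _ _ hx' hk hx' hk' (by
    unfold gridAdj; simp)) y y' hy hy'
  exact h2.1 (h1.1 h)

theorem gridPreconnected_box (n : ℕ) : GridPreconnected (gridBox n) := by
  rintro A ⟨s, hs, hAs⟩ ⟨t, ht, hAt⟩
  by_contra! hc
  rw [mem_gridBox] at hs ht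
  refine hAt (gridPreconnected_aux (Set.Icc (-n : ℤ) n) (Set.Icc (-n : ℤ) n) Set.ordConnected_Icc
    Set.ordConnected_Icc A ?_ s t hs.1 hs.2 ht.1 ht.2 hAs)
  intro a b ha ha' hb hb' hab
  have ha := mem_gridBox.2 ⟨ha, ha'⟩
  have hb := mem_gridBox.2 ⟨hb, hb'⟩
  constructor
  · intro h
    by_contra hn
    exact hc a ha b hb h hn hab
  · intro h
    by_contra hn
    exact hc b hb a ha h hn hab.symm

/-- Connected disjoint sets of grid vertices, together with connected disjoint sets joining those
that belong to adjacent vertices, give a grid model. -/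
theorem exists_gridModel_of_discrete {N : Type*} [Fintype N] [Nonempty N] {P : SimpleGraph N}
    (n : ℕ) (R : N → Finset (ℤ × ℤ)) (L : P.edgeSet → Finset (ℤ × ℤ))
    (hRn : ∀ p, R p ⊆ gridBox n) (hLn : ∀ e, L e ⊆ gridBox n)
    (hR : ∀ p, GridPreconnected (R p)) (hL : ∀ e, GridPreconnected (L e))
    (hRne : ∀ p, (R p).Nonempty)
    (hRR : ∀ p q, p ≠ q → Disjoint (R p) (R q)) (hLL : ∀ e f, e ≠ f → Disjoint (L e) (L f))
    (hLR : ∀ e p, (∃ s ∈ L e, s ∈ R p) ↔ p ∈ (e : Sym2 N)) : Nonempty (GridModel P) := by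
  classical
  have : Fintype P.edgeSet := Fintype.ofFinite _
  choose root hroot using hRne
  have inv : ∀ p s, ∀ q, s ∈ R p → s ∈ R q → p = q := by
    intro p s q hp hq
    by_contra h
    exact Finset.disjoint_left.1 (hRR p q h) hp hq
  let fib₀ : ℤ × ℤ → N := fun s => if h : ∃ p, s ∈ R p then h.choose else Classical.arbitrary N
  have hfib₀ : ∀ p, ∀ s ∈ R p, fib₀ s = p := by
    intro p s hs
    have h : ∃ p, s ∈ R p := ⟨p, hs⟩
    simp only [fib₀, dif_pos h]
    exact inv _ _ _ h.choose_spec hs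
  have hF₀ : IsGridForest n root (Finset.univ.image root) fib₀ (fun _ => 0) := by
    refine ⟨?_, fun p => Finset.mem_image_of_mem _ (Finset.mem_univ p),
      fun p => hfib₀ p _ (hroot p), ?_⟩
    · intro s hs
      obtain ⟨p, -, rfl⟩ := Finset.mem_image.1 hs
      exact hRn p (hroot p)
    · intro s hs h
      obtain ⟨p, -, rfl⟩ := Finset.mem_image.1 hs
      rw [hfib₀ p _ (hroot p)] at h
      exact absurd rfl h
  obtain ⟨fib₁, height₁, hF₁, -, h1⟩ := hF₀.exists_grow_family R hRn hR hRR
    (fun p => ⟨root p, hroot p, Finset.mem_image_of_mem _ (Finset.mem_univ p)⟩) Finset.univ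
  set D₁ := Finset.univ.image root ∪ Finset.univ.biUnion R with hD₁
  have hfib₁ : ∀ p, ∀ s ∈ R p, fib₁ s = p := by
    intro p s hs
    obtain ⟨t, ht, -, hst⟩ := h1 p (Finset.mem_univ p) s hs
    rw [hst, hfib₀ p t ht]
  have hmem₁ : ∀ s, s ∈ D₁ ↔ ∃ p, s ∈ R p := by
    intro s
    simp only [hD₁, Finset.mem_union, Finset.mem_image, Finset.mem_biUnion, Finset.mem_univ,
      true_and]
    constructor
    · rintro (⟨p, rfl⟩ | h)
      · exact ⟨p, hroot p⟩
      · exact h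
    · exact Or.inr
  have hLD : ∀ e : P.edgeSet, ∃ s ∈ L e, s ∈ D₁ := by
    rintro ⟨e, he⟩
    induction e with | _ u v
    obtain ⟨s, hs, hs'⟩ := (hLR ⟨s(u, v), he⟩ u).2 (Sym2.mem_mk_left u v)
    exact ⟨s, hs, (hmem₁ s).2 ⟨u, hs'⟩⟩
  obtain ⟨fib₂, height₂, hF₂, h2, h3⟩ := hF₁.exists_grow_family L hLn hL hLL hLD Finset.univ
  obtain ⟨fib₃, height₃, hF₃, h4, -⟩ := hF₂.exists_grow (gridBox n) subset_rfl
    (gridPreconnected_box n) _ rfl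
    (by
      obtain ⟨p⟩ := ‹Nonempty N›
      exact ⟨root p, hRn p (hroot p), Finset.mem_union_left _ ((hmem₁ _).2 ⟨p, hroot p⟩)⟩)
  rw [Finset.union_eq_right.2 hF₂.subset] at hF₃
  refine ⟨⟨n, fib₃, height₃, root, hF₃.root_mem, hF₃.fib_root, hF₃.parent, ?_⟩⟩
  intro u v huv
  let e : P.edgeSet := ⟨s(u, v), huv⟩
  have hfib : ∀ s ∈ L e, fib₃ s = u ∨ fib₃ s = v := by
    intro s hs
    obtain ⟨t, ht, htD, hst⟩ := h3 e (Finset.mem_univ e) s hs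
    obtain ⟨p, hp⟩ := (hmem₁ t).1 htD
    rw [h4 s (Finset.mem_union_right _ (Finset.mem_biUnion.2 ⟨e, Finset.mem_univ e, hs⟩)), hst,
      hfib₁ p t hp]
    exact Sym2.mem_iff.1 ((hLR e p).1 ⟨t, ht, hp⟩)
  have hend : ∀ p, ∀ s ∈ R p, fib₃ s = p := by
    intro p s hs
    have hs1 := (hmem₁ s).2 ⟨p, hs⟩
    rw [h4 s (Finset.mem_union_left _ hs1), h2 s hs1, hfib₁ p s hs]
  obtain ⟨a, ha, ha'⟩ := (hLR e u).2 (Sym2.mem_mk_left u v)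
  obtain ⟨b, hb, hb'⟩ := (hLR e v).2 (Sym2.mem_mk_right u v)
  obtain ⟨s, hs, t, ht, hsu, htu, hst⟩ := hL e (fun s => fib₃ s = u) ⟨a, ha, hend u a ha'⟩
    ⟨b, hb, by rw [hend v b hb']; exact huv.ne'⟩
  exact ⟨s, hLn e hs, t, hLn e ht, hst, hsu, (hfib t ht).resolve_left htu⟩

theorem exists_lattice_point_near {δ : ℝ} (hδ : 0 < δ) (c : ℝ) : ∃ k : ℤ, |c - δ * k| < δ := by
  refine ⟨round (c / δ), ?_⟩
  have h := abs_sub_round (c / δ)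
  have h1 : c - δ * round (c / δ) = δ * (c / δ - round (c / δ)) := by field_simp
  rw [h1, abs_mul, abs_of_pos hδ]
  nlinarith

theorem ordConnected_lattice_near (δ : ℝ) (hδ : 0 < δ) (c : ℝ) :
    {k : ℤ | |c - δ * k| < 2 * δ}.OrdConnected := by
  refine ⟨fun a ha b hb k hk => ?_⟩
  rw [Set.mem_ofPred_eq, abs_lt] at ha hb ⊢
  have h1 : δ * a ≤ δ * k := mul_le_mul_of_nonneg_left (by exact_mod_cast hk.1) hδ.le
  have h2 : δ * k ≤ δ * b := mul_le_mul_of_nonneg_left (by exact_mod_cast hk.2) hδ.le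
  exact ⟨by linarith [hb.1], by linarith [ha.2]⟩

/-- The vertex `s` of the grid of mesh `δ` is close to the point `c`. -/
def IsGridNear (δ : ℝ) (c : ℝ × ℝ) (s : ℤ × ℤ) : Prop :=
  |c.1 - δ * s.1| < 2 * δ ∧ |c.2 - δ * s.2| < 2 * δ

theorem exists_isGridNear_both {δ : ℝ} (hδ : 0 < δ) {c c' : ℝ × ℝ} (h : dist c c' < δ) :
    ∃ s, IsGridNear δ c s ∧ IsGridNear δ c' s := by
  obtain ⟨k, hk⟩ := exists_lattice_point_near hδ c.1
  obtain ⟨l, hl⟩ := exists_lattice_point_near hδ c.2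
  rw [Prod.dist_eq, max_lt_iff, Real.dist_eq, Real.dist_eq] at h
  rw [abs_lt, abs_lt] at h
  rw [abs_lt] at hk hl
  refine ⟨(k, l), ⟨?_, ?_⟩, ?_, ?_⟩ <;> rw [abs_lt] <;> constructor <;> dsimp only <;> linarith [h.1.1, h.1.2, h.2.1, h.2.2, hk.1, hk.2, hl.1, hl.2]

theorem exists_isGridNear {δ : ℝ} (hδ : 0 < δ) (c : ℝ × ℝ) : ∃ s, IsGridNear δ c s := by
  obtain ⟨s, hs, -⟩ := exists_isGridNear_both hδ (c := c) (c' := c) (by simpa using hδ)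
  exact ⟨s, hs⟩

theorem IsGridNear.dist_lt {δ : ℝ} {c c' : ℝ × ℝ} {s : ℤ × ℤ} (h : IsGridNear δ c s)
    (h' : IsGridNear δ c' s) : dist c c' < 4 * δ := by
  obtain ⟨h1, h2⟩ := h
  obtain ⟨h3, h4⟩ := h'
  rw [abs_lt] at h1 h2 h3 h4
  rw [Prod.dist_eq, max_lt_iff, Real.dist_eq, Real.dist_eq, abs_lt, abs_lt]
  refine ⟨⟨?_, ?_⟩, ?_, ?_⟩ <;> linarith [h1.1, h1.2, h2.1, h2.2, h3.1, h3.2, h4.1, h4.2]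

/-- The grid vertices close to a connected set form a connected set. -/
theorem gridPreconnected_of_isPreconnected {δ : ℝ} (hδ : 0 < δ) {C : Set (ℝ × ℝ)}
    (hC : IsPreconnected C) (Y : Finset (ℤ × ℤ)) (hY : ∀ s, s ∈ Y ↔ ∃ c ∈ C, IsGridNear δ c s) :
    GridPreconnected Y := by
  rintro A ⟨s, hs, hAs⟩ ⟨t, ht, hAt⟩
  by_contra! hcon
  have hbox : ∀ c ∈ C, ∀ s t, IsGridNear δ c s → IsGridNear δ c t → A s → A t := by
    intro c hc s t hs ht hAs
    refine gridPreconnected_aux {k : ℤ | |c.1 - δ * k| < 2 * δ} {k : ℤ | |c.2 - δ * k| < 2 * δ}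
      (ordConnected_lattice_near δ hδ _) (ordConnected_lattice_near δ hδ _) A ?_ s t
      hs.1 hs.2 ht.1 ht.2 hAs
    intro a b ha ha' hb hb' hab
    have ha := (hY a).2 ⟨c, hc, ha, ha'⟩
    have hb := (hY b).2 ⟨c, hc, hb, hb'⟩
    constructor
    · intro h
      by_contra hn
      exact hcon a ha b hb h hn hab
    · intro h
      by_contra hn
      exact hcon b hb a ha h hn hab.symm
  obtain ⟨c, hc, hcs⟩ := (hY s).1 hs
  obtain ⟨d, hd, hdt⟩ := (hY t).1 ht
  have := hC.induction₂'
    (fun x y => (∃ s, IsGridNear δ x s ∧ A s) → ∃ s, IsGridNear δ y s ∧ A s) ?_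
    (fun x y z _ _ _ h h' hx => h' (h hx)) hc hd ⟨s, hcs, hAs⟩
  · obtain ⟨u, hu, hAu⟩ := this
    exact hAt (hbox d hd u t hu hdt hAu)
  · intro x hx
    filter_upwards [self_mem_nhdsWithin, mem_nhdsWithin_of_mem_nhds (Metric.ball_mem_nhds x hδ)]
      with y hy hyx
    obtain ⟨v, hv, hv'⟩ := exists_isGridNear_both hδ (Metric.mem_ball.1 hyx)
    exact ⟨fun ⟨s, hs, hAs⟩ => ⟨v, hv, hbox x hx s v hs hv' hAs⟩,
      fun ⟨s, hs, hAs⟩ => ⟨v, hv', hbox y hy s v hs hv hAs⟩⟩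

theorem exists_pos_separation {ι : Type*} [Finite ι] (C : ι → Set (ℝ × ℝ))
    (hc : ∀ i, IsCompact (C i)) :
    ∃ δ > 0, ∀ i j, Disjoint (C i) (C j) → ∀ x ∈ C i, ∀ y ∈ C j, 4 * δ ≤ dist x y := by
  have key : ∀ i j, ∀ᶠ δ in nhdsWithin 0 (Set.Ioi (0 : ℝ)),
      Disjoint (C i) (C j) → ∀ x ∈ C i, ∀ y ∈ C j, 4 * δ ≤ dist x y := by
    intro i j
    by_cases h : Disjoint (C i) (C j)
    · obtain ⟨r, hr, hr'⟩ := h.exists_thickenings (hc i) (hc j).isClosed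
      filter_upwards [mem_nhdsWithin_of_mem_nhds (Iio_mem_nhds (by positivity : 0 < r / 4))]
        with δ hδ _ x hx y hy
      by_contra! hlt
      refine Set.disjoint_left.1 hr' (Metric.mem_thickening_iff.2 ⟨x, hx, ?_⟩)
        (Metric.self_subset_thickening hr _ hy)
      rw [dist_comm]
      rw [Set.mem_Iio] at hδ
      linarith
    · exact Filter.Eventually.of_forall fun _ h' => absurd h' h
  obtain ⟨δ, hδ, hpos⟩ := ((Filter.eventually_all.2 fun i =>
    Filter.eventually_all.2 (key i)).and self_mem_nhdsWithin).exists
  exact ⟨δ, hpos, hδ⟩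

/-- A finite family of compact connected plane sets can be replaced by connected sets of vertices
of a sufficiently fine grid. -/
theorem exists_grid_family {ι : Type*} [Finite ι] (C : ι → Set (ℝ × ℝ))
    (hc : ∀ i, IsCompact (C i)) (hC : ∀ i, IsPreconnected (C i)) :
    ∃ (n : ℕ) (Y : ι → Finset (ℤ × ℤ)), (∀ i, Y i ⊆ gridBox n) ∧ (∀ i, GridPreconnected (Y i)) ∧
      ∀ i j, (∃ s ∈ Y i, s ∈ Y j) ↔ (C i ∩ C j).Nonempty := by
  classical
  obtain ⟨δ, hδ, hsep⟩ := exists_pos_separation C hc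
  have hb : Bornology.IsBounded (⋃ i, C i) :=
    (isCompact_iUnion hc).isBounded
  obtain ⟨R, hR⟩ := hb.subset_closedBall (0 : ℝ × ℝ)
  obtain ⟨n, hn⟩ := exists_nat_ge (R / δ + 2)
  have hn' : R + 2 * δ ≤ n * δ := by
    have := mul_le_mul_of_nonneg_right hn hδ.le
    rwa [add_mul, div_mul_cancel₀ _ hδ.ne'] at this
  have hcoord : ∀ (c : ℝ) (k : ℤ), |c| ≤ R → |c - δ * k| < 2 * δ → -(n : ℤ) ≤ k ∧ k ≤ n := by
    intro c k h1 h2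
    rw [abs_le] at h1
    rw [abs_lt] at h2
    have h3 : ((k : ℤ) : ℝ) ≤ n := by nlinarith [h1.1, h1.2, h2.1, h2.2]
    have h4 : -(n : ℝ) ≤ k := by nlinarith [h1.1, h1.2, h2.1, h2.2]
    exact ⟨by exact_mod_cast h4, by exact_mod_cast h3⟩
  have hbox : ∀ i, ∀ c ∈ C i, ∀ s, IsGridNear δ c s → s ∈ gridBox n := by
    intro i c hci s hs
    have h := hR (Set.mem_iUnion.2 ⟨i, hci⟩)
    rw [mem_closedBall_zero_iff, Prod.norm_def, max_le_iff, Real.norm_eq_abs,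
      Real.norm_eq_abs] at h
    exact mem_gridBox.2 ⟨hcoord _ _ h.1 hs.1, hcoord _ _ h.2 hs.2⟩
  have hmem : ∀ i s, s ∈ (gridBox n).filter (fun s => ∃ c ∈ C i, IsGridNear δ c s) ↔
      ∃ c ∈ C i, IsGridNear δ c s := by
    intro i s
    rw [Finset.mem_filter, and_iff_right_iff_imp]
    rintro ⟨c, hci, hs⟩
    exact hbox i c hci s hs
  refine ⟨n, fun i => (gridBox n).filter fun s => ∃ c ∈ C i, IsGridNear δ c s,
    fun i => Finset.filter_subset _ _,
    fun i => gridPreconnected_of_isPreconnected hδ (hC i) _ (hmem i), fun i j => ?_⟩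
  simp only [hmem]
  constructor
  · rintro ⟨s, ⟨c, hc, hcs⟩, c', hc', hcs'⟩
    by_contra h
    rw [Set.not_nonempty_iff_eq_empty, ← Set.disjoint_iff_inter_eq_empty] at h
    exact absurd (hcs.dist_lt hcs') (not_lt.2 (hsep i j h c hc c' hc'))
  · rintro ⟨c, hc, hc'⟩
    obtain ⟨s, hs⟩ := exists_isGridNear hδ c
    exact ⟨s, ⟨c, hc, hs⟩, c, hc', hs⟩

/-- Disjoint compact connected plane sets, together with disjoint compact connected sets joining
those that belong to adjacent vertices, give a grid model. -/
theorem exists_gridModel_of_isCompact {N : Type*} [Fintype N] [Nonempty N] {P : SimpleGraph N}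
    (R : N → Set (ℝ × ℝ)) (L : P.edgeSet → Set (ℝ × ℝ))
    (hRc : ∀ p, IsCompact (R p)) (hLc : ∀ e, IsCompact (L e))
    (hR : ∀ p, IsConnected (R p)) (hL : ∀ e, IsPreconnected (L e))
    (hRR : ∀ p q, p ≠ q → Disjoint (R p) (R q)) (hLL : ∀ e f, e ≠ f → Disjoint (L e) (L f))
    (hLR : ∀ e p, (L e ∩ R p).Nonempty ↔ p ∈ (e : Sym2 N)) : Nonempty (GridModel P) := by
  have : Finite P.edgeSet := inferInstance
  obtain ⟨n, Y, hYn, hY, hYY⟩ := exists_grid_family (Sum.elim R L)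
    (by rintro (p | e); exacts [hRc p, hLc e]) (by rintro (p | e); exacts [(hR p).2, hL e])
  have hdisj : ∀ i j, Disjoint (Sum.elim R L i) (Sum.elim R L j) → Disjoint (Y i) (Y j) := by
    intro i j h
    rw [Finset.disjoint_left]
    intro s hs hs'
    exact Set.not_nonempty_iff_eq_empty.2 (Set.disjoint_iff_inter_eq_empty.1 h)
      ((hYY i j).1 ⟨s, hs, hs'⟩)
  refine exists_gridModel_of_discrete n (fun p => Y (.inl p)) (fun e => Y (.inr e))
    (fun p => hYn _) (fun e => hYn _) (fun p => hY _) (fun e => hY _) (fun p => ?_)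
    (fun p q h => hdisj _ _ (hRR p q h)) (fun e f h => hdisj _ _ (hLL e f h))
    (fun e p => (hYY _ _).trans (hLR e p))
  obtain ⟨s, hs, -⟩ := (hYY (.inl p) (.inl p)).2 (by simpa using (hR p).nonempty)
  exact ⟨s, hs⟩

/-- The graph obtained from `G` by placing a new vertex on each crossing; `T a b x` says that the
edge `ab` runs through the crossing `x`. Only the edge pieces that end in a vertex of `G` and in a
crossing, and the uncrossed edges of `G`, are edges. -/
def SimpleGraph.planarization {V X : Type*} (G : SimpleGraph V) (T : V → V → X → Prop)
    (hT : ∀ a b x, T a b x → T b a x) : SimpleGraph (V ⊕ X) where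
  Adj
    | .inl a, .inl b => G.Adj a b ∧ ∀ x, ¬ T a b x
    | .inl a, .inr x => ∃ b, T a b x
    | .inr x, .inl a => ∃ b, T a b x
    | .inr _, .inr _ => False
  symm := ⟨by
    rintro (a | x) (b | y) h
    · exact ⟨h.1.symm, fun x hx => h.2 x (hT _ _ _ hx)⟩
    · exact h
    · exact h
    · exact h⟩
  loopless := ⟨by
    rintro (a | x) h
    · exact h.1.ne rfl
    · exact h⟩

namespace OnePlanarDrawing

variable {V : Type*} {G : SimpleGraph V} (D : OnePlanarDrawing G)

/-- The relative interior of a drawn edge. -/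
def openArc (e : G.edgeSet) : Set (ℝ × ℝ) := D.arc e '' Set.Ioo 0 1

/-- The points in which edges without a common end cross. -/
def Crossing : Type := {x : ℝ × ℝ // ∃ e f : G.edgeSet, e ≠ f ∧
  (∀ w ∈ (e : Sym2 V), w ∉ (f : Sym2 V)) ∧ x ∈ D.openArc e ∧ x ∈ D.openArc f}

/-- The edge `ab` runs through the crossing `x`. -/
def Thru (a b : V) (x : D.Crossing) : Prop :=
  ∃ e : G.edgeSet, (e : Sym2 V) = s(a, b) ∧ x.1 ∈ D.openArc e

theorem Thru.symm {a b : V} {x : D.Crossing} (h : D.Thru a b x) : D.Thru b a x := by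
  obtain ⟨e, he, hx⟩ := h
  exact ⟨e, he.trans Sym2.eq_swap, hx⟩

/-- The position of a vertex of the planarization. -/
def point : V ⊕ D.Crossing → ℝ × ℝ := Sum.elim D.pos Subtype.val

/-- The piece of an edge of the planarization comes from the edge `e`. -/
def ComesFrom (k : Sym2 (V ⊕ D.Crossing)) (e : G.edgeSet) : Prop :=
  ∃ a b, (e : Sym2 V) = s(a, b) ∧ ((k = s(.inl a, .inl b) ∧ ∀ x, ¬ D.Thru a b x) ∨
    ∃ x : D.Crossing, x.1 ∈ D.openArc e ∧ k = s(.inl a, .inr x))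

theorem exists_comesFrom (k : (G.planarization D.Thru fun _ _ _ => Thru.symm D).edgeSet) :
    ∃ e, D.ComesFrom k e := by
  obtain ⟨k, hk⟩ := k
  induction k with | _ p q
  rcases p with a | x <;> rcases q with b | y
  · exact ⟨⟨s(a, b), hk.1⟩, a, b, rfl, .inl ⟨rfl, hk.2⟩⟩
  · obtain ⟨b, e, he, hx⟩ := hk
    exact ⟨e, a, b, he, .inr ⟨y, hx, rfl⟩⟩
  · obtain ⟨c, e, he, hx⟩ := hk
    exact ⟨e, b, c, he, .inr ⟨x, hx, Sym2.eq_swap⟩⟩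
  · exact hk.elim

/-- Intervals of the parameter range of the edge `e` that are contracted to the vertices of the
planarization, and intervals that represent its edges. -/
structure IsEdgeCover (e : G.edgeSet) (I : V ⊕ D.Crossing → Set ℝ)
    (J : Sym2 (V ⊕ D.Crossing) → Set ℝ) : Prop where
  compact : ∀ p, IsCompact (I p)
  compact' : ∀ k, IsCompact (J k)
  preconnected : ∀ p, IsPreconnected (I p)
  preconnected' : ∀ k, IsPreconnected (J k)
  subset : ∀ p, I p ⊆ Set.Icc 0 1
  subset' : ∀ k, J k ⊆ Set.Icc 0 1
  eq_of_mem : ∀ p q t, t ∈ I p → t ∈ I q → p = q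
  eq_of_mem' : ∀ k l t, t ∈ J k → t ∈ J l → k = l
  mem_of_mem : ∀ k p t, t ∈ J k → t ∈ I p → p ∈ k
  inter_nonempty : ∀ k p, D.ComesFrom k e → p ∈ k → (J k ∩ I p).Nonempty
  point_mem : ∀ p, (I p).Nonempty → ∃ t ∈ I p, D.arc e t = D.point p
  meet : ∀ f, f ≠ e → ∀ t ∈ Set.Icc (0 : ℝ) 1, ∀ t' ∈ Set.Icc (0 : ℝ) 1, D.arc e t = D.arc f t' →
    (∀ k, t ∉ J k) ∧ (∀ w ∈ (e : Sym2 V), w ∈ (f : Sym2 V) → t ∈ I (.inl w)) ∧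
    ((∀ w ∈ (e : Sym2 V), w ∉ (f : Sym2 V)) →
      ∃ x : D.Crossing, x.1 = D.arc e t ∧ t ∈ I (.inr x))

theorem arc_zero_or_one_of_mem_range {e : G.edgeSet} {t : ℝ} (ht : t ∈ Set.Icc (0 : ℝ) 1)
    (h : D.arc e t ∈ Set.range D.pos) : t = 0 ∨ t = 1 := by
  by_contra! hn
  exact D.arc_avoids e t ⟨lt_of_le_of_ne ht.1 hn.1.symm, lt_of_le_of_ne ht.2 hn.2⟩ h

theorem mem_of_arc_eq_pos {e : G.edgeSet} {t : ℝ} (ht : t ∈ Set.Icc (0 : ℝ) 1) {w : V}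
    (h : D.arc e t = D.pos w) : w ∈ (e : Sym2 V) := by
  obtain ⟨u, v, he, hu, hv⟩ := D.arc_ends e
  rw [he, Sym2.mem_iff]
  rcases D.arc_zero_or_one_of_mem_range ht ⟨w, h.symm⟩ with rfl | rfl
  · exact .inl (D.pos_inj (h.symm.trans hu))
  · exact .inr (D.pos_inj (h.symm.trans hv))

theorem eq_of_crosses {e f g : G.edgeSet} (hf : f ≠ e) (hg : g ≠ e) {x y : ℝ × ℝ}
    (hxe : x ∈ D.openArc e) (hxf : x ∈ D.openArc f) (hye : y ∈ D.openArc e)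
    (hyg : y ∈ D.openArc g) : g = f ∧ y = x := by
  obtain rfl : g = f := D.at_most_one_crossing e ⟨hg, y, hye, hyg⟩ ⟨hf, x, hxe, hxf⟩
  exact ⟨rfl, D.crossings_subsingleton e g hf.symm ⟨hye, hyg⟩ ⟨hxe, hxf⟩⟩

/-- The edge through a crossing has a partner there. -/
theorem exists_partner (x : D.Crossing) {e : G.edgeSet} (he : x.1 ∈ D.openArc e) :
    ∃ f, f ≠ e ∧ (∀ w ∈ (e : Sym2 V), w ∉ (f : Sym2 V)) ∧ x.1 ∈ D.openArc f := by
  obtain ⟨x, f, g, hfg, hd, hf, hg⟩ := x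
  by_cases h : f = e
  · subst h
    exact ⟨g, hfg.symm, hd, hg⟩
  · by_cases h' : g = e
    · subst h'
      exact ⟨f, hfg, fun w hw hw' => hd w hw' hw, hf⟩
    · exact absurd (D.eq_of_crosses h h' he hf he hg).1.symm hfg

theorem inter_interior {e f : G.edgeSet} {t t' : ℝ} (ht : t ∈ Set.Ioo (0 : ℝ) 1)
    (ht' : t' ∈ Set.Icc (0 : ℝ) 1) (h : D.arc e t = D.arc f t') : D.arc e t ∈ D.openArc f := by
  refine ⟨t', ?_, h.symm⟩
  have hn : D.arc f t' ∉ Set.range D.pos := h ▸ D.arc_avoids e t ht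
  obtain ⟨u, v, -, hu, hv⟩ := D.arc_ends f
  refine ⟨lt_of_le_of_ne ht'.1 ?_, lt_of_le_of_ne ht'.2 ?_⟩
  · rintro rfl
    exact hn ⟨u, hu.symm⟩
  · rintro rfl
    exact hn ⟨v, hv.symm⟩

theorem eq_of_mem_both {e f : G.edgeSet} (h : f ≠ e) {v w : V} (hv : v ∈ (e : Sym2 V))
    (hv' : v ∈ (f : Sym2 V)) (hw : w ∈ (e : Sym2 V)) (hw' : w ∈ (f : Sym2 V)) : v = w := by
  by_contra hne
  apply h
  rw [Subtype.ext_iff, (Sym2.mem_and_mem_iff hne).1 ⟨hv, hw⟩,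
    (Sym2.mem_and_mem_iff hne).1 ⟨hv', hw'⟩]

theorem ends_ne {e : G.edgeSet} {u v : V} (he : (e : Sym2 V) = s(u, v)) : u ≠ v := by
  have h := e.2
  rw [he] at h
  exact h.ne

/-- An edge that crosses no edge, or crosses an edge with which it shares an end, can be cut in the
middle. -/
theorem exists_isEdgeCover_of_split {e : G.edgeSet} {u v : V} (he : (e : Sym2 V) = s(u, v))
    (hu : D.arc e 0 = D.pos u) (hv : D.arc e 1 = D.pos v) {a b : ℝ} (ha : 0 < a) (hab : a < b)
    (hb : b < 1) (hx : ∀ x : D.Crossing, x.1 ∉ D.openArc e)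
    (hsplit : ∀ f, f ≠ e → ∀ t ∈ Set.Ioo (0 : ℝ) 1, D.arc e t ∈ D.openArc f →
      (u ∈ (f : Sym2 V) ∧ t < a) ∨ (v ∈ (f : Sym2 V) ∧ b < t)) :
    ∃ I J, D.IsEdgeCover e I J := by
  classical
  have huv := ends_ne he
  have hne : (Sum.inl u : V ⊕ D.Crossing) ≠ Sum.inl v := fun h => huv (Sum.inl.inj h)
  let I : V ⊕ D.Crossing → Set ℝ := fun p =>
    if p = .inl u then Set.Icc 0 a else if p = .inl v then Set.Icc b 1 else ∅
  let J : Sym2 (V ⊕ D.Crossing) → Set ℝ := fun k =>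
    if k = s(.inl u, .inl v) then Set.Icc a b else ∅
  have hIu : I (.inl u) = Set.Icc 0 a := if_pos rfl
  have hIv : I (.inl v) = Set.Icc b 1 := by simp only [I, if_neg hne.symm, if_true]
  have hJ : J s(.inl u, .inl v) = Set.Icc a b := if_pos rfl
  have hIp : ∀ p t, t ∈ I p → (p = .inl u ∧ t ∈ Set.Icc 0 a) ∨ (p = .inl v ∧ t ∈ Set.Icc b 1) := by
    intro p t ht
    simp only [I] at ht
    split_ifs at ht with h1 h2
    · exact .inl ⟨h1, ht⟩
    · exact .inr ⟨h2, ht⟩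
    · exact ht.elim
  have hJk : ∀ k t, t ∈ J k → k = s(.inl u, .inl v) ∧ t ∈ Set.Icc a b := by
    intro k t ht
    simp only [J] at ht
    split_ifs at ht with h1
    · exact ⟨h1, ht⟩
    · exact ht.elim
  refine ⟨I, J, ⟨?_, ?_, ?_, ?_, ?_, ?_, ?_, ?_, ?_, ?_, ?_, ?_⟩⟩
  · intro p
    simp only [I]
    split_ifs
    exacts [isCompact_Icc, isCompact_Icc, isCompact_empty]
  · intro k
    simp only [J]
    split_ifs
    exacts [isCompact_Icc, isCompact_empty]
  · intro p
    simp only [I]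
    split_ifs
    exacts [isPreconnected_Icc, isPreconnected_Icc, isPreconnected_empty]
  · intro k
    simp only [J]
    split_ifs
    exacts [isPreconnected_Icc, isPreconnected_empty]
  · intro p t ht
    rcases hIp p t ht with ⟨-, h⟩ | ⟨-, h⟩ <;> exact ⟨by linarith [h.1], by linarith [h.2]⟩
  · intro k t ht
    obtain ⟨-, h⟩ := hJk k t ht
    exact ⟨by linarith [h.1], by linarith [h.2]⟩
  · intro p q t hp hq
    rcases hIp p t hp with ⟨rfl, h⟩ | ⟨rfl, h⟩ <;> rcases hIp q t hq with ⟨rfl, h'⟩ | ⟨rfl, h'⟩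
    · rfl
    · linarith [h.2, h'.1]
    · linarith [h.1, h'.2]
    · rfl
  · intro k l t hk hl
    rw [(hJk k t hk).1, (hJk l t hl).1]
  · intro k p t hk hp
    rw [(hJk k t hk).1]
    rcases hIp p t hp with ⟨rfl, -⟩ | ⟨rfl, -⟩
    · exact Sym2.mem_mk_left _ _
    · exact Sym2.mem_mk_right _ _
  · rintro k p ⟨c, d, hcd, ⟨rfl, -⟩ | ⟨x, hxe, -⟩⟩ hp
    · have hk : (s(.inl c, .inl d) : Sym2 (V ⊕ D.Crossing)) = s(.inl u, .inl v) := by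
        rw [he] at hcd
        exact (congrArg (Sym2.map Sum.inl) hcd).symm
      rw [hk] at hp ⊢
      rw [hJ]
      rcases Sym2.mem_iff.1 hp with rfl | rfl
      · rw [hIu]
        exact ⟨a, ⟨le_rfl, hab.le⟩, ha.le, le_rfl⟩
      · rw [hIv]
        exact ⟨b, ⟨hab.le, le_rfl⟩, le_rfl, hb.le⟩
    · exact absurd hxe (hx x)
  · rintro p ⟨t, ht⟩
    rcases hIp p t ht with ⟨rfl, h⟩ | ⟨rfl, h⟩
    · exact ⟨0, by rw [hIu]; exact ⟨le_rfl, ha.le⟩, hu⟩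
    · exact ⟨1, by rw [hIv]; exact ⟨hb.le, le_rfl⟩, hv⟩
  · intro f hf t ht t' ht' h
    have hue : u ∈ (e : Sym2 V) := by rw [he]; exact Sym2.mem_mk_left _ _
    have hve : v ∈ (e : Sym2 V) := by rw [he]; exact Sym2.mem_mk_right _ _
    have main : (u ∈ (f : Sym2 V) ∧ t < a) ∨ (v ∈ (f : Sym2 V) ∧ b < t) := by
      rcases eq_or_lt_of_le ht.1 with rfl | h0
      · exact .inl ⟨D.mem_of_arc_eq_pos ht' (h.symm.trans hu), ha⟩
      · rcases eq_or_lt_of_le ht.2 with rfl | h1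
        · exact .inr ⟨D.mem_of_arc_eq_pos ht' (h.symm.trans hv), hb⟩
        · exact hsplit f hf t ⟨h0, h1⟩ (D.inter_interior ⟨h0, h1⟩ ht' h)
    refine ⟨fun k hk => ?_, fun w hw hw' => ?_, fun hn => ?_⟩
    · have := (hJk k t hk).2
      rcases main with ⟨-, h⟩ | ⟨-, h⟩ <;> linarith [this.1, this.2]
    · rcases main with ⟨hf', h⟩ | ⟨hf', h⟩
      · rw [← eq_of_mem_both hf hue hf' hw hw', hIu]
        exact ⟨ht.1, h.le⟩
      · rw [← eq_of_mem_both hf hve hf' hw hw', hIv]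
        exact ⟨h.le, ht.2⟩
    · rcases main with ⟨hf', -⟩ | ⟨hf', -⟩
      · exact absurd hf' (hn u hue)
      · exact absurd hf' (hn v hve)

/-- An edge through a crossing is cut into two pieces. -/
theorem exists_isEdgeCover_of_crossing {e : G.edgeSet} {u v : V} (he : (e : Sym2 V) = s(u, v))
    (hu : D.arc e 0 = D.pos u) (hv : D.arc e 1 = D.pos v) (x : D.Crossing)
    (hx : x.1 ∈ D.openArc e) : ∃ I J, D.IsEdgeCover e I J := by
  classical
  have huv := ends_ne he
  obtain ⟨g, hge, hgd, hxg⟩ := D.exists_partner x hx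
  obtain ⟨s, hs, hsx⟩ := id hx
  have huniq : ∀ f, f ≠ e → ∀ t ∈ Set.Ioo (0 : ℝ) 1, D.arc e t ∈ D.openArc f → f = g ∧ t = s := by
    intro f hf t ht h
    obtain ⟨h1, h2⟩ := D.eq_of_crosses hge hf hx hxg ⟨t, ht, rfl⟩ h
    exact ⟨h1, D.arc_inj e ⟨ht.1.le, ht.2.le⟩ ⟨hs.1.le, hs.2.le⟩ (h2.trans hsx.symm)⟩
  obtain ⟨b, hb0, hbs⟩ := exists_between hs.1
  obtain ⟨a, ha, hab⟩ := exists_between hb0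
  obtain ⟨c, hsc, hc1⟩ := exists_between hs.2
  obtain ⟨d, hcd, hd⟩ := exists_between hc1
  have hne : (Sum.inl u : V ⊕ D.Crossing) ≠ Sum.inl v := fun h => huv (Sum.inl.inj h)
  have hkl : (s(.inl v, .inr x) : Sym2 (V ⊕ D.Crossing)) ≠ s(.inl u, .inr x) := by
    intro h
    rcases Sym2.eq_iff.1 h with ⟨h, -⟩ | ⟨h, -⟩
    · exact hne h.symm
    · exact Sum.inl_ne_inr h
  let I : V ⊕ D.Crossing → Set ℝ := fun p =>
    if p = .inl u then Set.Icc 0 a else if p = .inl v then Set.Icc d 1 else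
    if p = .inr x then Set.Icc b c else ∅
  let J : Sym2 (V ⊕ D.Crossing) → Set ℝ := fun k =>
    if k = s(.inl u, .inr x) then Set.Icc a b else if k = s(.inl v, .inr x) then Set.Icc c d else ∅
  have hIu : I (.inl u) = Set.Icc 0 a := if_pos rfl
  have hIv : I (.inl v) = Set.Icc d 1 := by simp only [I, if_neg hne.symm, if_true]
  have hIx : I (.inr x) = Set.Icc b c := by simp [I]
  have hJu : J s(.inl u, .inr x) = Set.Icc a b := if_pos rfl
  have hJv : J s(.inl v, .inr x) = Set.Icc c d := by simp only [J, if_neg hkl, if_true]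
  have hIp : ∀ p t, t ∈ I p → (p = .inl u ∧ t ∈ Set.Icc 0 a) ∨ (p = .inl v ∧ t ∈ Set.Icc d 1) ∨
      (p = .inr x ∧ t ∈ Set.Icc b c) := by
    intro p t ht
    simp only [I] at ht
    split_ifs at ht with h1 h2 h3
    · exact .inl ⟨h1, ht⟩
    · exact .inr (.inl ⟨h2, ht⟩)
    · exact .inr (.inr ⟨h3, ht⟩)
    · exact ht.elim
  have hJk : ∀ k t, t ∈ J k → (k = s(.inl u, .inr x) ∧ t ∈ Set.Icc a b) ∨
      (k = s(.inl v, .inr x) ∧ t ∈ Set.Icc c d) := by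
    intro k t ht
    simp only [J] at ht
    split_ifs at ht with h1 h2
    · exact .inl ⟨h1, ht⟩
    · exact .inr ⟨h2, ht⟩
    · exact ht.elim
  refine ⟨I, J, ⟨?_, ?_, ?_, ?_, ?_, ?_, ?_, ?_, ?_, ?_, ?_, ?_⟩⟩
  · intro p
    simp only [I]
    split_ifs
    exacts [isCompact_Icc, isCompact_Icc, isCompact_Icc, isCompact_empty]
  · intro k
    simp only [J]
    split_ifs
    exacts [isCompact_Icc, isCompact_Icc, isCompact_empty]
  · intro p
    simp only [I]
    split_ifs
    exacts [isPreconnected_Icc, isPreconnected_Icc, isPreconnected_Icc, isPreconnected_empty]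
  · intro k
    simp only [J]
    split_ifs
    exacts [isPreconnected_Icc, isPreconnected_Icc, isPreconnected_empty]
  · intro p t ht
    rcases hIp p t ht with ⟨-, h⟩ | ⟨-, h⟩ | ⟨-, h⟩ <;>
      exact ⟨by linarith [h.1], by linarith [h.2]⟩
  · intro k t ht
    rcases hJk k t ht with ⟨-, h⟩ | ⟨-, h⟩ <;> exact ⟨by linarith [h.1], by linarith [h.2]⟩
  · intro p q t hp hq
    rcases hIp p t hp with ⟨rfl, h⟩ | ⟨rfl, h⟩ | ⟨rfl, h⟩ <;>
      rcases hIp q t hq with ⟨rfl, h'⟩ | ⟨rfl, h'⟩ | ⟨rfl, h'⟩ <;>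
      first
      | rfl
      | linarith [h.1, h.2, h'.1, h'.2]
  · intro k l t hk hl
    rcases hJk k t hk with ⟨rfl, h⟩ | ⟨rfl, h⟩ <;>
      rcases hJk l t hl with ⟨rfl, h'⟩ | ⟨rfl, h'⟩ <;>
      first
      | rfl
      | linarith [h.1, h.2, h'.1, h'.2]
  · intro k p t hk hp
    rcases hJk k t hk with ⟨rfl, h⟩ | ⟨rfl, h⟩ <;>
      rcases hIp p t hp with ⟨rfl, h'⟩ | ⟨rfl, h'⟩ | ⟨rfl, h'⟩ <;>
      first
      | exact Sym2.mem_mk_left _ _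
      | exact Sym2.mem_mk_right _ _
      | linarith [h.1, h.2, h'.1, h'.2]
  · rintro k p ⟨y, z, hyz, ⟨rfl, hno⟩ | ⟨x', hxe, rfl⟩⟩ hp
    · exact absurd ⟨e, hyz, hx⟩ (hno x)
    · obtain rfl : x' = x := by
        obtain ⟨f, hf, -, hxf⟩ := D.exists_partner x' hxe
        exact Subtype.ext (D.eq_of_crosses hge hf hx hxg hxe hxf).2
      have hy : y ∈ s(u, v) := he ▸ hyz ▸ Sym2.mem_mk_left _ _
      rcases Sym2.mem_iff.1 hy with rfl | rfl
      · rw [hJu]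
        rcases Sym2.mem_iff.1 hp with rfl | rfl
        · rw [hIu]
          exact ⟨a, ⟨le_rfl, hab.le⟩, ha.le, le_rfl⟩
        · rw [hIx]
          exact ⟨b, ⟨hab.le, le_rfl⟩, le_rfl, (hbs.trans hsc).le⟩
      · rw [hJv]
        rcases Sym2.mem_iff.1 hp with rfl | rfl
        · rw [hIv]
          exact ⟨d, ⟨hcd.le, le_rfl⟩, le_rfl, hd.le⟩
        · rw [hIx]
          exact ⟨c, ⟨le_rfl, hcd.le⟩, (hbs.trans hsc).le, le_rfl⟩
  · rintro p ⟨t, ht⟩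
    rcases hIp p t ht with ⟨rfl, h⟩ | ⟨rfl, h⟩ | ⟨rfl, h⟩
    · exact ⟨0, by rw [hIu]; exact ⟨le_rfl, ha.le⟩, hu⟩
    · exact ⟨1, by rw [hIv]; exact ⟨hd.le, le_rfl⟩, hv⟩
    · exact ⟨s, by rw [hIx]; exact ⟨hbs.le, hsc.le⟩, hsx⟩
  · intro f hf t ht t' ht' h
    have hue : u ∈ (e : Sym2 V) := by rw [he]; exact Sym2.mem_mk_left _ _
    have hve : v ∈ (e : Sym2 V) := by rw [he]; exact Sym2.mem_mk_right _ _
    have main : (u ∈ (f : Sym2 V) ∧ t = 0) ∨ (v ∈ (f : Sym2 V) ∧ t = 1) ∨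
        (f = g ∧ t = s) := by
      rcases eq_or_lt_of_le ht.1 with rfl | h0
      · exact .inl ⟨D.mem_of_arc_eq_pos ht' (h.symm.trans hu), rfl⟩
      · rcases eq_or_lt_of_le ht.2 with rfl | h1
        · exact .inr (.inl ⟨D.mem_of_arc_eq_pos ht' (h.symm.trans hv), rfl⟩)
        · exact .inr (.inr (huniq f hf t ⟨h0, h1⟩ (D.inter_interior ⟨h0, h1⟩ ht' h)))
    refine ⟨fun k hk => ?_, fun w hw hw' => ?_, fun hn => ?_⟩
    · rcases hJk k t hk with ⟨-, h'⟩ | ⟨-, h'⟩ <;>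
        rcases main with ⟨-, h⟩ | ⟨-, h⟩ | ⟨-, h⟩ <;> linarith [h'.1, h'.2]
    · rcases main with ⟨hf', h⟩ | ⟨hf', h⟩ | ⟨rfl, -⟩
      · rw [← eq_of_mem_both hf hue hf' hw hw', hIu]
        exact ⟨ht.1, by linarith⟩
      · rw [← eq_of_mem_both hf hve hf' hw hw', hIv]
        exact ⟨by linarith, ht.2⟩
      · exact absurd hw' (hgd w hw)
    · rcases main with ⟨hf', -⟩ | ⟨hf', -⟩ | ⟨rfl, rfl⟩
      · exact absurd hf' (hn u hue)
      · exact absurd hf' (hn v hve)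
      · exact ⟨x, hsx.symm, by rw [hIx]; exact ⟨hbs.le, hsc.le⟩⟩

theorem exists_isEdgeCover (e : G.edgeSet) : ∃ I J, D.IsEdgeCover e I J := by
  obtain ⟨u, v, he, hu, hv⟩ := D.arc_ends e
  by_cases hx : ∃ x : D.Crossing, x.1 ∈ D.openArc e
  · obtain ⟨x, hx⟩ := hx
    exact D.exists_isEdgeCover_of_crossing he hu hv x hx
  push Not at hx
  by_cases hf : ∃ f, f ≠ e ∧ ∃ s ∈ Set.Ioo (0 : ℝ) 1, D.arc e s ∈ D.openArc f
  · obtain ⟨f, hfe, s, hs, hsf⟩ := hf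
    have huniq : ∀ g, g ≠ e → ∀ t ∈ Set.Ioo (0 : ℝ) 1, D.arc e t ∈ D.openArc g →
        g = f ∧ t = s := by
      intro g hg t ht h
      obtain ⟨h1, h2⟩ := D.eq_of_crosses hfe hg ⟨s, hs, rfl⟩ hsf ⟨t, ht, rfl⟩ h
      exact ⟨h1, D.arc_inj e ⟨ht.1.le, ht.2.le⟩ ⟨hs.1.le, hs.2.le⟩ h2⟩
    have hshare : u ∈ (f : Sym2 V) ∨ v ∈ (f : Sym2 V) := by
      by_contra! hn
      refine hx ⟨D.arc e s, e, f, hfe.symm, fun w hw => ?_, ⟨s, hs, rfl⟩, hsf⟩ ⟨s, hs, rfl⟩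
      rw [he] at hw
      rcases Sym2.mem_iff.1 hw with rfl | rfl
      exacts [hn.1, hn.2]
    rcases hshare with hshare | hshare
    · obtain ⟨a, hsa, ha⟩ := exists_between hs.2
      obtain ⟨b, hab, hb⟩ := exists_between ha
      refine D.exists_isEdgeCover_of_split he hu hv (hs.1.trans hsa) hab hb hx
        fun g hg t ht h => ?_
      obtain ⟨rfl, rfl⟩ := huniq g hg t ht h
      exact .inl ⟨hshare, hsa⟩
    · obtain ⟨b, hb, hbs⟩ := exists_between hs.1
      obtain ⟨a, ha, hab⟩ := exists_between hb
      refine D.exists_isEdgeCover_of_split he hu hv ha hab (hbs.trans hs.2) hx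
        fun g hg t ht h => ?_
      obtain ⟨rfl, rfl⟩ := huniq g hg t ht h
      exact .inr ⟨hshare, hbs⟩
  · push Not at hf
    exact D.exists_isEdgeCover_of_split he hu hv (a := 1 / 3) (b := 2 / 3) (by norm_num)
      (by norm_num) (by norm_num) hx fun f hfe t ht h => absurd h (hf f hfe t ht)

/-- The graph of a drawing whose crossings are replaced by vertices. -/
abbrev planarGraph : SimpleGraph (V ⊕ D.Crossing) :=
  G.planarization D.Thru fun _ _ _ => Thru.symm D

theorem finite_crossing [Finite V] : Finite D.Crossing := by
  choose e f hef _ he hf using fun x : D.Crossing => x.2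
  refine Finite.of_injective (fun x => (e x, f x)) fun x y h => ?_
  simp only [Prod.mk.injEq] at h
  have hy := he y
  have hy' := hf y
  rw [← h.1] at hy
  rw [← h.2] at hy'
  exact Subtype.ext (D.crossings_subsingleton _ _ (hef x) ⟨he x, hf x⟩ ⟨hy, hy'⟩)

theorem exists_planarGraph_adj (hdeg : ∀ v, ∃ w, G.Adj v w) (p : V ⊕ D.Crossing) :
    ∃ q, D.planarGraph.Adj p q := by
  rcases p with v | x
  · obtain ⟨w, hw⟩ := hdeg v
    by_cases h : ∃ x, D.Thru v w x
    · obtain ⟨x, hx⟩ := h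
      exact ⟨.inr x, w, hx⟩
    · push Not at h
      exact ⟨.inl w, hw, h⟩
  · obtain ⟨⟨e, he⟩, -, -, -, hx, -⟩ := x.2
    induction e with | _ u v
    exact ⟨.inl u, v, ⟨_, he⟩, rfl, hx⟩

theorem nonempty_gridModel [Finite V] [Nonempty V] [Fintype (V ⊕ D.Crossing)]
    (hdeg : ∀ v, ∃ w, G.Adj v w) : Nonempty (GridModel D.planarGraph) := by
  have : Finite G.edgeSet := inferInstance
  choose I J hIJ using D.exists_isEdgeCover
  choose e he using D.exists_comesFrom
  have himage : ∀ e p, IsPreconnected (D.arc e '' I e p) := fun e p =>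
    ((hIJ e).preconnected p).image _ ((D.arc_cont e).mono ((hIJ e).subset p))
  have hinj : ∀ e t t', t ∈ Set.Icc (0 : ℝ) 1 → t' ∈ Set.Icc (0 : ℝ) 1 →
      D.arc e t = D.arc e t' → t = t' := fun e t t' ht ht' h => D.arc_inj e ht ht' h
  refine exists_gridModel_of_isCompact (fun p => ⋃ e, D.arc e '' I e p)
    (fun k => D.arc (e k) '' J (e k) k) (fun p => isCompact_iUnion fun e =>
      ((hIJ e).compact p).image_of_continuousOn ((D.arc_cont e).mono ((hIJ e).subset p)))
    (fun k => ((hIJ _).compact' k).image_of_continuousOn ((D.arc_cont _).mono ((hIJ _).subset' k)))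
    (fun p => ⟨?_, ?_⟩)
    (fun k => ((hIJ _).preconnected' k).image _ ((D.arc_cont _).mono ((hIJ _).subset' k)))
    (fun p q hpq => ?_) (fun k l hkl => ?_) fun k p => ?_
  · obtain ⟨q, hpq⟩ := D.exists_planarGraph_adj hdeg p
    obtain ⟨t, -, ht⟩ := (hIJ (e ⟨s(p, q), hpq⟩)).inter_nonempty _ p (he _) (Sym2.mem_mk_left p q)
    exact ⟨_, Set.mem_iUnion.2 ⟨_, t, ht, rfl⟩⟩
  · refine isPreconnected_of_forall (D.point p) fun y hy => ?_
    obtain ⟨e, t, ht, rfl⟩ := Set.mem_iUnion.1 hy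
    obtain ⟨t', ht', htp⟩ := (hIJ e).point_mem p ⟨t, ht⟩
    exact ⟨D.arc e '' I e p, Set.subset_iUnion (fun e => D.arc e '' I e p) e, ⟨t', ht', htp⟩,
      ⟨t, ht, rfl⟩, himage e p⟩
  · rw [Set.disjoint_left]
    rintro y hy hy'
    obtain ⟨e, t, ht, rfl⟩ := Set.mem_iUnion.1 hy
    obtain ⟨f, t', ht', h⟩ := Set.mem_iUnion.1 hy'
    have htm := (hIJ e).subset p ht
    have htm' := (hIJ f).subset q ht'
    apply hpq
    by_cases hef : f = e
    · subst hef
      obtain rfl := hinj _ _ _ htm' htm h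
      exact (hIJ _).eq_of_mem p q _ ht ht'
    · obtain ⟨-, h1, h2⟩ := (hIJ e).meet f hef t htm t' htm' h.symm
      obtain ⟨-, h1', h2'⟩ := (hIJ f).meet e (Ne.symm hef) t' htm' t htm h
      by_cases hw : ∃ w ∈ (e : Sym2 V), w ∈ (f : Sym2 V)
      · obtain ⟨w, hw, hw'⟩ := hw
        rw [(hIJ e).eq_of_mem p _ t ht (h1 w hw hw'), (hIJ f).eq_of_mem q _ t' ht' (h1' w hw' hw)]
      · push Not at hw
        obtain ⟨x, hx, hxt⟩ := h2 hw
        obtain ⟨x', hx', hxt'⟩ := h2' fun w hw' hw'' => hw w hw'' hw'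
        rw [(hIJ e).eq_of_mem p _ t ht hxt, (hIJ f).eq_of_mem q _ t' ht' hxt']
        exact congrArg Sum.inr (Subtype.ext (hx.trans (h.symm.trans hx'.symm)))
  · rw [Set.disjoint_left]
    rintro - ⟨t, ht, rfl⟩ ⟨t', ht', h⟩
    have htm := (hIJ _).subset' _ ht
    have htm' := (hIJ _).subset' _ ht'
    by_cases hef : e l = e k
    · rw [hef] at ht' h
      rw [hinj _ _ _ (by exact htm') htm h] at ht'
      exact hkl (Subtype.ext ((hIJ _).eq_of_mem' _ _ t ht ht'))
    · exact ((hIJ _).meet _ hef t htm t' htm' h.symm).1 _ ht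
  · constructor
    · rintro ⟨-, ⟨t, ht, rfl⟩, hy⟩
      obtain ⟨f, t', ht', h⟩ := Set.mem_iUnion.1 hy
      have htm := (hIJ _).subset' _ ht
      have htm' := (hIJ f).subset p ht'
      by_cases hef : f = e k
      · subst hef
        obtain rfl := hinj _ _ _ htm' htm h
        exact (hIJ _).mem_of_mem _ p _ ht ht'
      · exact absurd ht (((hIJ _).meet _ hef t htm t' htm' h.symm).1 _)
    · intro hp
      obtain ⟨t, ht, ht'⟩ := (hIJ (e k)).inter_nonempty k p (he k) hp
      exact ⟨_, ⟨t, ht, rfl⟩, Set.mem_iUnion.2 ⟨_, t, ht', rfl⟩⟩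

theorem Thru.adj {a b : V} {x : D.Crossing} (h : D.Thru a b x) : G.Adj a b := by
  obtain ⟨⟨e, he⟩, rfl, -⟩ := h
  exact he

theorem Thru.right_unique {a b c : V} {x : D.Crossing} (h : D.Thru a b x) (h' : D.Thru a c x) :
    b = c := by
  obtain ⟨e, he, hx⟩ := h
  obtain ⟨f, hf, hx'⟩ := h'
  obtain ⟨g, hge, hgd, hxg⟩ := D.exists_partner x hx
  by_cases hef : f = e
  · subst hef
    exact Sym2.congr_right.1 (he.symm.trans hf)
  · obtain ⟨rfl, -⟩ := D.eq_of_crosses hge hef hx hxg hx hx'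
    exact absurd (hf ▸ Sym2.mem_mk_left a c) (hgd a (he ▸ Sym2.mem_mk_left a b))

theorem Thru.crossing_unique {a b : V} {x y : D.Crossing} (h : D.Thru a b x) (h' : D.Thru a b y) :
    x = y := by
  obtain ⟨e, he, hx⟩ := h
  obtain ⟨e', he', hy⟩ := h'
  obtain rfl : e' = e := Subtype.ext (he'.trans he.symm)
  obtain ⟨g, hge, -, hxg⟩ := D.exists_partner x hx
  obtain ⟨g', hge', -, hyg⟩ := D.exists_partner y hy
  exact Subtype.ext (D.eq_of_crosses hge hge' hx hxg hy hyg).2.symm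

/-- Exactly two edges, without common ends, run through a crossing. -/
theorem exists_thru_pair {v w : V} {x : D.Crossing} (h : D.Thru v w x) :
    ∃ a b, D.Thru a b x ∧ v ≠ a ∧ v ≠ b ∧ w ≠ a ∧ w ≠ b ∧
      ∀ p q, D.Thru p q x → s(p, q) = s(v, w) ∨ s(p, q) = s(a, b) := by
  obtain ⟨e, he, hx⟩ := h
  obtain ⟨⟨f, hf⟩, hfe, hd, hxf⟩ := D.exists_partner x hx
  induction f with | _ a b
  have hv := hd v (he ▸ Sym2.mem_mk_left v w)
  have hw := hd w (he ▸ Sym2.mem_mk_right v w)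
  simp only [Sym2.mem_iff, not_or] at hv hw
  refine ⟨a, b, ⟨_, rfl, hxf⟩, hv.1, hv.2, hw.1, hw.2, ?_⟩
  rintro p q ⟨g, hg, hxg⟩
  by_cases hge : g = e
  · exact .inl (by rw [← hg, hge, he])
  · obtain ⟨rfl, -⟩ := D.eq_of_crosses hfe hge hx hxf hx hxg
    exact .inr hg.symm

theorem exists_thru (x : D.Crossing) : ∃ v w, D.Thru v w x := by
  obtain ⟨⟨e, he⟩, -, -, -, hx, -⟩ := x.2
  induction e with | _ u v
  exact ⟨u, v, _, rfl, hx⟩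

end OnePlanarDrawing

/-- The graph `P` arises from `G` by placing new vertices on the crossings of pairs of edges;
`T a b x` says that the edge `ab` runs through the crossing `x`. -/
structure IsPlanarization {V X : Type*} (G : SimpleGraph V) (T : V → V → X → Prop)
    (P : SimpleGraph (V ⊕ X)) : Prop where
  adj_inl : ∀ a b, P.Adj (.inl a) (.inl b) ↔ G.Adj a b ∧ ∀ x, ¬ T a b x
  adj_inr : ∀ a x, P.Adj (.inl a) (.inr x) ↔ ∃ b, T a b x
  not_adj : ∀ x y, ¬ P.Adj (.inr x) (.inr y)
  symm : ∀ a b x, T a b x → T b a x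
  adj : ∀ a b x, T a b x → G.Adj a b
  right_unique : ∀ a b c x, T a b x → T a c x → b = c
  crossing_unique : ∀ a b x y, T a b x → T a b y → x = y
  exists_thru : ∀ x, ∃ v w, T v w x
  exists_pair : ∀ v w x, T v w x → ∃ a b, T a b x ∧ v ≠ a ∧ v ≠ b ∧ w ≠ a ∧ w ≠ b ∧
    ∀ p q, T p q x → s(p, q) = s(v, w) ∨ s(p, q) = s(a, b)

theorem OnePlanarDrawing.isPlanarization {V : Type*} {G : SimpleGraph V}
    (D : OnePlanarDrawing G) : IsPlanarization G D.Thru D.planarGraph where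
  adj_inl _ _ := Iff.rfl
  adj_inr _ _ := Iff.rfl
  not_adj _ _ := id
  symm _ _ _ := Thru.symm D
  adj _ _ _ := Thru.adj D
  right_unique _ _ _ _ := Thru.right_unique D
  crossing_unique _ _ _ _ := Thru.crossing_unique D
  exists_thru := D.exists_thru
  exists_pair _ _ _ := D.exists_thru_pair

namespace IsPlanarization

variable {V X : Type*} [Fintype V] [Fintype X] {G : SimpleGraph V} {T : V → V → X → Prop}
  {P : SimpleGraph (V ⊕ X)} [DecidableRel P.Adj]

theorem degree_inl [DecidableRel G.Adj] (h : IsPlanarization G T P) (v : V) :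
    P.degree (.inl v) = G.degree v := by
  classical
  let φ : V → V ⊕ X := fun w => if hx : ∃ x, T v w x then .inr hx.choose else .inl w
  have hφ : ∀ w, (∃ x, T v w x ∧ φ w = .inr x) ∨ ((∀ x, ¬ T v w x) ∧ φ w = .inl w) := by
    intro w
    by_cases hx : ∃ x, T v w x
    · exact .inl ⟨hx.choose, hx.choose_spec, dif_pos hx⟩
    · exact .inr ⟨not_exists.1 hx, dif_neg hx⟩
  rw [SimpleGraph.degree, SimpleGraph.degree]
  symm
  refine Finset.card_bij (fun w _ => φ w) (fun w hw => ?_) (fun w _ w' _ hww => ?_)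
    fun p hp => ?_
  · rw [SimpleGraph.mem_neighborFinset] at hw ⊢
    rcases hφ w with ⟨x, hx, hw'⟩ | ⟨hx, hw'⟩
    · rw [hw', h.adj_inr]
      exact ⟨w, hx⟩
    · rw [hw', h.adj_inl]
      exact ⟨hw, hx⟩
  · rcases hφ w with ⟨x, hx, hw⟩ | ⟨hx, hw⟩ <;> rcases hφ w' with ⟨x', hx', hw'⟩ | ⟨hx', hw'⟩ <;>
      rw [hw, hw'] at hww
    · obtain rfl := Sum.inr.inj hww
      exact h.right_unique _ _ _ _ hx hx'
    · exact absurd hww (by simp)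
    · exact absurd hww (by simp)
    · exact Sum.inl.inj hww
  · rw [SimpleGraph.mem_neighborFinset] at hp
    rcases p with w | x
    · rw [h.adj_inl] at hp
      refine ⟨w, by simpa using hp.1, ?_⟩
      rcases hφ w with ⟨x, hx, -⟩ | ⟨-, hw⟩
      · exact absurd hx (hp.2 x)
      · exact hw
    · obtain ⟨w, hw⟩ := (h.adj_inr _ _).1 hp
      refine ⟨w, by simpa using h.adj _ _ _ hw, ?_⟩
      rcases hφ w with ⟨x', hx', hw'⟩ | ⟨hx', -⟩
      · rw [hw', h.crossing_unique _ _ _ _ hx' hw]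
      · exact absurd hw (hx' x)

theorem four_le_degree_inr (h : IsPlanarization G T P) (x : X) : 4 ≤ P.degree (.inr x) := by
  classical
  obtain ⟨v, w, hvw⟩ := h.exists_thru x
  obtain ⟨a, b, hab, h1, h2, h3, h4, -⟩ := h.exists_pair v w x hvw
  have h5 := (h.adj _ _ _ hvw).ne
  have h6 := (h.adj _ _ _ hab).ne
  have hcard : ({.inl v, .inl w, .inl a, .inl b} : Finset (V ⊕ X)).card = 4 := by
    rw [Finset.card_insert_of_notMem, Finset.card_insert_of_notMem, Finset.card_insert_of_notMem,
      Finset.card_singleton] <;> simp [h1, h2, h3, h4, h5, h6]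
  rw [← hcard]
  refine Finset.card_le_card fun p hp => ?_
  rw [SimpleGraph.mem_neighborFinset, SimpleGraph.adj_comm]
  simp only [Finset.mem_insert, Finset.mem_singleton] at hp
  rcases hp with rfl | rfl | rfl | rfl
  exacts [(h.adj_inr _ _).2 ⟨w, hvw⟩, (h.adj_inr _ _).2 ⟨v, h.symm _ _ _ hvw⟩,
    (h.adj_inr _ _).2 ⟨b, hab⟩, (h.adj_inr _ _).2 ⟨a, h.symm _ _ _ hab⟩]

theorem sum_degree_le [DecidableRel G.Adj] (h : IsPlanarization G T P) :
    ∑ v, G.degree v + 4 * Fintype.card X ≤ 2 * P.edgeFinset.card := by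
  rw [← SimpleGraph.sum_degrees_eq_twice_card_edges, Fintype.sum_sum_type]
  simp only [h.degree_inl]
  have := Finset.card_nsmul_le_sum Finset.univ (fun x : X => P.degree (.inr x)) 4
    fun x _ => h.four_le_degree_inr x
  rw [smul_eq_mul, Finset.card_univ] at this
  omega

end IsPlanarization

/-- A family of triangles such that each edge lies in at most two of them. -/
structure IsTriangleFamily {N : Type*} [DecidableEq N] (P : SimpleGraph N)
    (F : Finset (Finset N)) : Prop where
  isNClique : ∀ t ∈ F, P.IsNClique 3 t
  card_le_two : ∀ u v, u ≠ v → (F.filter fun t => u ∈ t ∧ v ∈ t).card ≤ 2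

section

variable {V X : Type*} [DecidableEq V] [DecidableEq X]

/-- The triangles of a family that contain a vertex of the original graph. -/
def trianglesAt (F : Finset (Finset (V ⊕ X))) (v : V) : Finset (Finset (V ⊕ X)) :=
  F.filter fun t => .inl v ∈ t

theorem mem_trianglesAt {F : Finset (Finset (V ⊕ X))} {v : V} {t : Finset (V ⊕ X)} :
    t ∈ trianglesAt F v ↔ t ∈ F ∧ .inl v ∈ t :=
  Finset.mem_filter

namespace IsTriangleFamily

variable {P : SimpleGraph (V ⊕ X)} {F : Finset (Finset (V ⊕ X))}

theorem adj (hF : IsTriangleFamily P F) {t : Finset (V ⊕ X)} (ht : t ∈ F) {p q : V ⊕ X}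
    (hp : p ∈ t) (hq : q ∈ t) (h : p ≠ q) : P.Adj p q :=
  (hF.isNClique t ht).isClique hp hq h

theorem card_filter_le_two (hF : IsTriangleFamily P F) (v : V) {q : V ⊕ X} (hq : .inl v ≠ q) :
    ((trianglesAt F v).filter (q ∈ ·)).card ≤ 2 := by
  rw [trianglesAt, Finset.filter_filter]
  exact hF.card_le_two _ _ hq

/-- Double counting of the incidences between a set `S` of neighbours of `v` and the triangles
at `v`. -/
theorem sum_card_filter (F : Finset (Finset (V ⊕ X))) (v : V) (S : Finset (V ⊕ X)) :
    ∑ q ∈ S, ((trianglesAt F v).filter (q ∈ ·)).card = ∑ t ∈ trianglesAt F v, (S ∩ t).card := by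
  have := Finset.sum_card_bipartiteAbove_eq_sum_card_bipartiteBelow (s := S)
    (t := trianglesAt F v) (r := fun q t => q ∈ t)
  simpa [Finset.bipartiteAbove, Finset.bipartiteBelow, Finset.filter_mem_eq_inter] using this

variable [Fintype V] [Fintype X] [DecidableRel P.Adj]

theorem neighborFinset_inter (hF : IsTriangleFamily P F) {v : V} {t : Finset (V ⊕ X)}
    (ht : t ∈ trianglesAt F v) : P.neighborFinset (.inl v) ∩ t = t.erase (.inl v) := by
  obtain ⟨ht, hv⟩ := mem_trianglesAt.1 ht
  ext q
  rw [Finset.mem_inter, Finset.mem_erase, SimpleGraph.mem_neighborFinset]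
  exact ⟨fun h => ⟨h.1.ne', h.2⟩, fun h => ⟨hF.adj ht hv h.2 h.1.symm, h.2⟩⟩

theorem sum_neighborFinset (hF : IsTriangleFamily P F) (v : V) :
    ∑ q ∈ P.neighborFinset (.inl v), ((trianglesAt F v).filter (q ∈ ·)).card =
      2 * (trianglesAt F v).card := by
  rw [sum_card_filter, mul_comm, ← smul_eq_mul, Finset.sum_const_nat (m := 2), smul_eq_mul]
  intro t ht
  rw [hF.neighborFinset_inter ht, Finset.card_erase_of_mem (mem_trianglesAt.1 ht).2,
    (hF.isNClique t (mem_trianglesAt.1 ht).1).card_eq]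

theorem card_trianglesAt_le (hF : IsTriangleFamily P F) (v : V) :
    (trianglesAt F v).card ≤ P.degree (.inl v) := by
  have h := Finset.sum_le_card_nsmul (P.neighborFinset (.inl v))
    (fun q => ((trianglesAt F v).filter (q ∈ ·)).card) 2
    fun q hq => hF.card_filter_le_two v ((SimpleGraph.mem_neighborFinset _ _ _).1 hq).ne
  rw [hF.sum_neighborFinset, smul_eq_mul] at h
  rw [SimpleGraph.degree]
  omega

theorem card_filter_eq_two (hF : IsTriangleFamily P F) {v : V}
    (h : (trianglesAt F v).card = P.degree (.inl v)) {q : V ⊕ X} (hq : P.Adj (.inl v) q) :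
    ((trianglesAt F v).filter (q ∈ ·)).card = 2 := by
  have hle : ∀ q ∈ P.neighborFinset (.inl v), ((trianglesAt F v).filter (q ∈ ·)).card ≤ 2 :=
    fun q hq => hF.card_filter_le_two v ((SimpleGraph.mem_neighborFinset _ _ _).1 hq).ne
  refine (Finset.sum_eq_sum_iff_of_le hle).1 ?_ q (by simpa using hq)
  rw [hF.sum_neighborFinset, h, Finset.sum_const, smul_eq_mul, mul_comm, SimpleGraph.degree]

end IsTriangleFamily

end

/-- A triangle with a pendant edge all of whose vertices have degree at most `9`. -/
def HasLightPaw {V : Type*} [Fintype V] (G : SimpleGraph V) [DecidableRel G.Adj] : Prop :=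
  ∃ a b c d : V, a ≠ b ∧ a ≠ c ∧ a ≠ d ∧ b ≠ c ∧ b ≠ d ∧ c ≠ d ∧
    G.Adj a b ∧ G.Adj a c ∧ G.Adj b c ∧ G.Adj a d ∧
    G.degree a ≤ 9 ∧ G.degree b ≤ 9 ∧ G.degree c ≤ 9 ∧ G.degree d ≤ 9

/-- The neighbours of `v` in the planarization that are vertices of degree at most `9`. -/
def lightNeighbors {V X : Type*} [Fintype V] [Fintype X] (G : SimpleGraph V) [DecidableRel G.Adj]
    (P : SimpleGraph (V ⊕ X)) [DecidableRel P.Adj] (v : V) : Finset V :=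
  (P.neighborFinset (.inl v)).toLeft.filter fun w => G.degree w ≤ 9

theorem mem_lightNeighbors {V X : Type*} [Fintype V] [Fintype X] {G : SimpleGraph V}
    [DecidableRel G.Adj] {P : SimpleGraph (V ⊕ X)} [DecidableRel P.Adj] {v w : V} :
    w ∈ lightNeighbors G P v ↔ P.Adj (.inl v) (.inl w) ∧ G.degree w ≤ 9 := by
  simp [lightNeighbors]

section

variable {V X : Type*} [DecidableEq V] [DecidableEq X] {G : SimpleGraph V}
  {T : V → V → X → Prop} {P : SimpleGraph (V ⊕ X)} {F : Finset (Finset (V ⊕ X))}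

namespace IsPlanarization

theorem card_toRight_le_one (h : IsPlanarization G T P) (hF : IsTriangleFamily P F)
    {t : Finset (V ⊕ X)} (ht : t ∈ F) : t.toRight.card ≤ 1 := by
  rw [Finset.card_le_one]
  intro x hx y hy
  by_contra hxy
  exact h.not_adj x y (hF.adj ht (Finset.mem_toRight.1 hx) (Finset.mem_toRight.1 hy)
    fun h => hxy (Sum.inr.inj h))

theorem card_toLeft_add (hF : IsTriangleFamily P F) {t : Finset (V ⊕ X)} (ht : t ∈ F) :
    t.toLeft.card + t.toRight.card = 3 := by
  rw [Finset.card_toLeft_add_card_toRight, (hF.isNClique t ht).card_eq]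

/-- The two triangles that contain the vertex `v` and a crossing on an edge at `v` also contain
the ends of the edge that crosses there. -/
theorem exists_adj_of_card_eq_two (h : IsPlanarization G T P) (hF : IsTriangleFamily P F) {v : V}
    {x : X} (hx : ((trianglesAt F v).filter (.inr x ∈ ·)).card = 2) :
    ∃ a b, G.Adj a b ∧ a ≠ v ∧ b ≠ v ∧ (∃ t ∈ trianglesAt F v, .inr x ∈ t ∧ .inl a ∈ t) ∧
      ∃ t ∈ trianglesAt F v, .inr x ∈ t ∧ .inl b ∈ t := by
  have third : ∀ t ∈ (trianglesAt F v).filter (.inr x ∈ ·),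
      ∃ a, a ≠ v ∧ t = {.inl v, .inr x, .inl a} := by
    intro t ht
    obtain ⟨ht, hxt⟩ := Finset.mem_filter.1 ht
    obtain ⟨ht, hvt⟩ := mem_trianglesAt.1 ht
    have hcard : ((t.erase (.inl v)).erase (.inr x)).card = 1 := by
      rw [Finset.card_erase_of_mem (by simp [hxt]), Finset.card_erase_of_mem hvt,
        (hF.isNClique t ht).card_eq]
    obtain ⟨q, hq⟩ := Finset.card_eq_one.1 hcard
    have hqt : q ∈ (t.erase (.inl v)).erase (.inr x) := by simp [hq]
    simp only [Finset.mem_erase] at hqt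
    have ht' : t = {.inl v, .inr x, q} := by
      rw [← hq, Finset.insert_erase (by simp [hxt]), Finset.insert_erase hvt]
    rcases q with a | y
    · exact ⟨a, fun h => hqt.2.1 (h ▸ rfl), ht'⟩
    · exact absurd (hF.adj ht hqt.2.2 hxt hqt.1) (h.not_adj y x)
  obtain ⟨t₁, t₂, hne, ht₁₂⟩ := Finset.card_eq_two.1 hx
  have ht₁ : t₁ ∈ (trianglesAt F v).filter (.inr x ∈ ·) := by simp [ht₁₂]
  have ht₂ : t₂ ∈ (trianglesAt F v).filter (.inr x ∈ ·) := by simp [ht₁₂]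
  obtain ⟨a, hav, ha⟩ := third t₁ ht₁
  obtain ⟨b, hbv, hb⟩ := third t₂ ht₂
  have hat : Sum.inl a ∈ t₁ := by simp [ha]
  have hbt : Sum.inl b ∈ t₂ := by simp [hb]
  obtain ⟨ht₁, hx₁⟩ := Finset.mem_filter.1 ht₁
  obtain ⟨ht₂, hx₂⟩ := Finset.mem_filter.1 ht₂
  have hab : a ≠ b := fun hab => hne (by rw [ha, hb, hab])
  have hv₁ := mem_trianglesAt.1 ht₁
  have hv₂ := mem_trianglesAt.1 ht₂
  obtain ⟨w, hw⟩ := (h.adj_inr v x).1 (hF.adj hv₁.1 hv₁.2 hx₁ (by simp))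
  obtain ⟨c, d, hcd, -, -, -, -, hall⟩ := h.exists_pair v w x hw
  have base : ∀ a, a ≠ v → P.Adj (.inl v) (.inl a) → P.Adj (.inl a) (.inr x) → a = c ∨ a = d := by
    intro a hav hva hax
    obtain ⟨a', ha'⟩ := (h.adj_inr a x).1 hax
    rcases hall a a' ha' with h1 | h1
    · have h2 : a ∈ s(v, w) := h1 ▸ Sym2.mem_mk_left a a'
      rcases Sym2.mem_iff.1 h2 with h3 | h3
      · exact absurd h3 hav
      · exact absurd (h3 ▸ hw) (((h.adj_inl v a).1 hva).2 x)
    · exact Sym2.mem_iff.1 (h1 ▸ Sym2.mem_mk_left a a')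
  have ha' := base a hav (hF.adj hv₁.1 hv₁.2 hat (by simpa using hav.symm))
    (hF.adj hv₁.1 hat hx₁ (by simp))
  have hb' := base b hbv (hF.adj hv₂.1 hv₂.2 hbt (by simpa using hbv.symm))
    (hF.adj hv₂.1 hbt hx₂ (by simp))
  refine ⟨a, b, ?_, hav, hbv, ⟨t₁, ht₁, hx₁, hat⟩, t₂, ht₂, hx₂, hbt⟩
  have hadj := h.adj _ _ _ hcd
  rcases ha' with rfl | rfl <;> rcases hb' with rfl | rfl
  exacts [absurd rfl hab, hadj, hadj.symm, absurd rfl hab]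

end IsPlanarization

variable [Fintype V] [DecidableRel G.Adj]

/-- The number of vertices of degree at most `9` in a triangle. -/
def lightCount (G : SimpleGraph V) [DecidableRel G.Adj] (t : Finset (V ⊕ X)) : ℕ :=
  (t.toLeft.filter fun w => G.degree w ≤ 9).card

/-- The amount that the vertex `v` gives to the triangle `t` at `v`. -/
def share (G : SimpleGraph V) [DecidableRel G.Adj] (v : V) (t : Finset (V ⊕ X)) : ℕ :=
  if 9 < G.degree v then 18
  else if t.toRight.card = 0 then 4 * lightCount G t - 2 else 9 + 3 * lightCount G t

namespace IsPlanarization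

theorem le_sum_share (h : IsPlanarization G T P) (hF : IsTriangleFamily P F)
    {t : Finset (V ⊕ X)} (ht : t ∈ F) : 30 ≤ ∑ v ∈ t.toLeft, share G v t := by
  rw [← Finset.sum_filter_add_sum_filter_not t.toLeft (fun w => G.degree w ≤ 9)]
  have h1 : ∑ v ∈ t.toLeft.filter (fun w => ¬ G.degree w ≤ 9), share G v t =
      (t.toLeft.filter fun w => ¬ G.degree w ≤ 9).card * 18 := by
    refine Finset.sum_const_nat fun v hv => if_pos ?_
    exact not_le.1 (Finset.mem_filter.1 hv).2
  have h2 : ∑ v ∈ t.toLeft.filter (fun w => G.degree w ≤ 9), share G v t =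
      lightCount G t *
        if t.toRight.card = 0 then 4 * lightCount G t - 2 else 9 + 3 * lightCount G t := by
    refine Finset.sum_const_nat fun v hv => if_neg ?_
    exact not_lt.2 (Finset.mem_filter.1 hv).2
  have h3 : lightCount G t + (t.toLeft.filter fun w => ¬ G.degree w ≤ 9).card = t.toLeft.card :=
    Finset.card_filter_add_card_filter_not _
  have h4 := h.card_toRight_le_one hF ht
  have h5 := card_toLeft_add hF ht
  rw [h1, h2]
  generalize (t.toLeft.filter fun w => ¬ G.degree w ≤ 9).card = m at *
  generalize lightCount G t = l at *
  generalize t.toRight.card = c at *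
  have hl : l ≤ 3 := by omega
  interval_cases c <;> interval_cases l <;> simp <;> omega

variable [Fintype X] [DecidableRel P.Adj]

theorem lightCount_eq (hF : IsTriangleFamily P F) {v : V} (hv : G.degree v ≤ 9)
    {t : Finset (V ⊕ X)} (ht : t ∈ trianglesAt F v) :
    lightCount G t = ((lightNeighbors G P v).map .inl ∩ t).card + 1 := by
  obtain ⟨ht, hvt⟩ := mem_trianglesAt.1 ht
  have h1 : (lightNeighbors G P v).map .inl ∩ t =
      ((t.toLeft.filter fun w => G.degree w ≤ 9).erase v).map .inl := by
    ext (w | x)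
    · simp only [Finset.mem_inter, Finset.mem_map, mem_lightNeighbors, Finset.mem_erase,
        Finset.mem_filter, Finset.mem_toLeft, Function.Embedding.inl_apply, Sum.inl.injEq,
        exists_eq_right]
      constructor
      · rintro ⟨⟨h1, h2⟩, h3⟩
        exact ⟨fun h => h1.ne (h ▸ rfl), h3, h2⟩
      · rintro ⟨h1, h2, h3⟩
        exact ⟨⟨hF.adj ht hvt h2 (by simpa using Ne.symm h1), h3⟩, h2⟩
    · simp
  rw [h1, Finset.card_map, Finset.card_erase_add_one (by simp [hvt, hv]), lightCount]

theorem sum_lightCount (hF : IsTriangleFamily P F) {v : V} (hv : G.degree v ≤ 9)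
    (h7 : (trianglesAt F v).card = P.degree (.inl v)) :
    ∑ t ∈ trianglesAt F v, lightCount G t =
      2 * (lightNeighbors G P v).card + (trianglesAt F v).card := by
  rw [Finset.sum_congr rfl fun t ht => lightCount_eq hF hv ht, Finset.sum_add_distrib,
    ← IsTriangleFamily.sum_card_filter, Finset.sum_map, Finset.sum_const_nat (m := 2)]
  · simp [mul_comm]
  · intro w hw
    exact hF.card_filter_eq_two h7 (mem_lightNeighbors.1 hw).1

theorem sum_card_toRight (hF : IsTriangleFamily P F) {v : V}
    (h7 : (trianglesAt F v).card = P.degree (.inl v)) :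
    ∑ t ∈ trianglesAt F v, t.toRight.card = 2 * (P.neighborFinset (.inl v)).toRight.card := by
  have h1 : ∀ t ∈ trianglesAt F v, t.toRight.card =
      ((P.neighborFinset (.inl v)).toRight.map .inr ∩ t).card := by
    intro t ht
    obtain ⟨ht, hvt⟩ := mem_trianglesAt.1 ht
    rw [← Finset.card_map (f := (Function.Embedding.inr : X ↪ V ⊕ X))]
    congr 1
    ext (w | x)
    · simp
    · simp only [Finset.mem_inter, Finset.mem_map, Finset.mem_toRight,
        Function.Embedding.inr_apply, Sum.inr.injEq, exists_eq_right,
        SimpleGraph.mem_neighborFinset]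
      exact ⟨fun h => ⟨hF.adj ht hvt h (by simp), h⟩, And.right⟩
  rw [Finset.sum_congr rfl h1, ← IsTriangleFamily.sum_card_filter, Finset.sum_map,
    Finset.sum_const_nat (m := 2), mul_comm]
  intro x hx
  exact hF.card_filter_eq_two h7 (by simpa using hx)

theorem card_lightNeighbors_le_two (h : IsPlanarization G T P) (hF : IsTriangleFamily P F)
    (hpaw : ¬ HasLightPaw G) {v : V} (hv : G.degree v = 7)
    (h7 : (trianglesAt F v).card = P.degree (.inl v))
    (hB : (P.neighborFinset (.inl v)).toRight.card = 3) : (lightNeighbors G P v).card ≤ 2 := by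
  by_contra! hlt
  obtain ⟨S, hSL, hS⟩ := Finset.exists_subset_card_eq (show 3 ≤ (lightNeighbors G P v).card from hlt)
  have hSA : S ⊆ (P.neighborFinset (.inl v)).toLeft :=
    hSL.trans (Finset.filter_subset _ _)
  have hA : ((P.neighborFinset (.inl v)).toLeft \ S).card = 1 := by
    have h1 := Finset.card_toLeft_add_card_toRight (u := P.neighborFinset (.inl v))
    have h2 := h.degree_inl v
    rw [SimpleGraph.degree] at h2
    rw [Finset.card_sdiff_of_subset hSA]
    omega
  obtain ⟨y, hy⟩ := Finset.card_eq_one.1 hA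
  have hmem : ∀ a, P.Adj (.inl v) (.inl a) → a = y ∨ a ∈ S := by
    intro a ha
    by_cases haS : a ∈ S
    · exact .inr haS
    · refine .inl (Finset.mem_singleton.1 (hy ▸ Finset.mem_sdiff.2 ⟨?_, haS⟩))
      simpa using ha
  have hlight : ∀ a ∈ S, G.Adj v a ∧ G.degree a ≤ 9 := by
    intro a ha
    have := mem_lightNeighbors.1 (hSL ha)
    exact ⟨((h.adj_inl v a).1 this.1).1, this.2⟩
  have hvy : P.Adj (.inl v) (.inl y) := by
    have : y ∈ (P.neighborFinset (.inl v)).toLeft \ S := by simp [hy]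
    simpa using (Finset.mem_sdiff.1 this).1
  have hex : ∀ x ∈ (P.neighborFinset (.inl v)).toRight,
      ∃ t ∈ trianglesAt F v, .inr x ∈ t ∧ .inl y ∈ t := by
    intro x hx
    obtain ⟨a, b, hab, hav, hbv, ⟨t₁, ht₁, hx₁, ha⟩, t₂, ht₂, hx₂, hb⟩ :=
      h.exists_adj_of_card_eq_two hF (hF.card_filter_eq_two h7 (by simpa using hx))
    by_cases hay : a = y
    · exact ⟨t₁, ht₁, hx₁, hay ▸ ha⟩
    by_cases hby : b = y
    · exact ⟨t₂, ht₂, hx₂, hby ▸ hb⟩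
    have nbr : ∀ a, a ≠ v → a ≠ y → (∃ t ∈ trianglesAt F v, .inl a ∈ t) → a ∈ S := by
      rintro a hav hay ⟨t, ht, ha⟩
      exact (hmem a (hF.adj (mem_trianglesAt.1 ht).1 (mem_trianglesAt.1 ht).2 ha
        (by simpa using Ne.symm hav))).resolve_left hay
    have haS := nbr a hav hay ⟨t₁, ht₁, ha⟩
    have hbS := nbr b hbv hby ⟨t₂, ht₂, hb⟩
    have hcard : 0 < (S \ {a, b}).card := by
      have h1 := Finset.le_card_sdiff {a, b} S
      have h2 := Finset.card_le_two (a := a) (b := b)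
      omega
    obtain ⟨c, hc⟩ := Finset.card_pos.1 hcard
    simp only [Finset.mem_sdiff, Finset.mem_insert, Finset.mem_singleton, not_or] at hc
    obtain ⟨hcS, hca, hcb⟩ := hc
    exact absurd ⟨v, a, b, c, hav.symm, hbv.symm, (hlight c hcS).1.ne, hab.ne, Ne.symm hca,
      Ne.symm hcb, (hlight a haS).1, (hlight b hbS).1, hab, (hlight c hcS).1, by omega,
      (hlight a haS).2, (hlight b hbS).2, (hlight c hcS).2⟩ hpaw
  choose! f hf hfx hfy using hex
  have hinj : Set.InjOn f (P.neighborFinset (.inl v)).toRight := by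
    intro x hx x' hx' hxx
    by_contra hne
    have h1 := hfx x' hx'
    rw [← hxx] at h1
    exact h.not_adj x x' (hF.adj (mem_trianglesAt.1 (hf x hx)).1 (hfx x hx) h1
      fun h => hne (Sum.inr.inj h))
  have := Finset.card_le_card_of_injOn (t := (trianglesAt F v).filter (.inl y ∈ ·)) f
    (fun x hx => by simpa using ⟨hf x hx, hfy x hx⟩) hinj
  have := hF.card_filter_le_two v hvy.ne
  omega

theorem sum_share_le (h : IsPlanarization G T P) (hF : IsTriangleFamily P F)
    (hpaw : ¬ HasLightPaw G) {v : V} (hv : 7 ≤ G.degree v) :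
    ∑ t ∈ trianglesAt F v, share G v t ≤ 30 * (G.degree v - 4) := by
  have hcard := hF.card_trianglesAt_le v
  rw [h.degree_inl] at hcard
  by_cases hheavy : 9 < G.degree v
  · have : ∑ t ∈ trianglesAt F v, share G v t = (trianglesAt F v).card * 18 :=
      Finset.sum_const_nat fun t _ => if_pos hheavy
    omega
  have hlight : G.degree v ≤ 9 := not_lt.1 hheavy
  have hshare : ∀ t ∈ trianglesAt F v, share G v t ≤ 15 ∧
      share G v t ≤ 10 + 5 * t.toRight.card ∧
      share G v t ≤ 1 + 8 * t.toRight.card + 3 * lightCount G t := by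
    intro t ht
    have htF := (mem_trianglesAt.1 ht).1
    have h1 := h.card_toRight_le_one hF htF
    have h2 := card_toLeft_add hF htF
    have h3 : lightCount G t ≤ t.toLeft.card := Finset.card_filter_le _ _
    rw [share, if_neg hheavy]
    split_ifs <;> omega
  by_cases h8 : 8 ≤ G.degree v ∨ (trianglesAt F v).card ≤ 6
  · have : ∑ t ∈ trianglesAt F v, share G v t ≤ (trianglesAt F v).card • 15 :=
      Finset.sum_le_card_nsmul _ _ _ fun t ht => (hshare t ht).1
    rw [smul_eq_mul] at this
    omega
  have hv7 : G.degree v = 7 := by omega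
  have h7 : (trianglesAt F v).card = P.degree (.inl v) := by
    rw [h.degree_inl]
    omega
  have hB := sum_card_toRight hF h7
  have hL := sum_lightCount hF hlight h7
  have hB' : ∑ t ∈ trianglesAt F v, t.toRight.card ≤ (trianglesAt F v).card • 1 :=
    Finset.sum_le_card_nsmul _ _ _ fun t ht => h.card_toRight_le_one hF (mem_trianglesAt.1 ht).1
  rw [smul_eq_mul] at hB'
  by_cases hB2 : (P.neighborFinset (.inl v)).toRight.card ≤ 2
  · have : ∑ t ∈ trianglesAt F v, share G v t ≤
        ∑ t ∈ trianglesAt F v, (10 + 5 * t.toRight.card) :=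
      Finset.sum_le_sum fun t ht => (hshare t ht).2.1
    rw [Finset.sum_add_distrib, ← Finset.mul_sum, Finset.sum_const, smul_eq_mul] at this
    omega
  · have hS := h.card_lightNeighbors_le_two hF hpaw hv7 h7 (by omega)
    have : ∑ t ∈ trianglesAt F v, share G v t ≤
        ∑ t ∈ trianglesAt F v, (1 + 8 * t.toRight.card + 3 * lightCount G t) :=
      Finset.sum_le_sum fun t ht => (hshare t ht).2.2
    rw [Finset.sum_add_distrib, Finset.sum_add_distrib, ← Finset.mul_sum, ← Finset.mul_sum,
      Finset.sum_const, smul_eq_mul] at this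
    omega

theorem hasLightPaw (h : IsPlanarization G T P) (hF : IsTriangleFamily P F)
    (hmin : ∀ v, 7 ≤ G.degree v)
    (hcard : 2 * P.edgeFinset.card + 4 ≤ 4 * Fintype.card (V ⊕ X) + F.card) : HasLightPaw G := by
  by_contra hpaw
  have h1 : F.card * 30 ≤ ∑ t ∈ F, ∑ v ∈ t.toLeft, share G v t := by
    rw [← smul_eq_mul]
    exact Finset.card_nsmul_le_sum _ _ _ fun t ht => h.le_sum_share hF ht
  have h2 : ∑ t ∈ F, ∑ v ∈ t.toLeft, share G v t = ∑ v, ∑ t ∈ trianglesAt F v, share G v t := by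
    refine Finset.sum_comm' fun t v => ?_
    simp [mem_trianglesAt]
  have h3 := Finset.sum_le_sum fun v (_ : v ∈ Finset.univ) => h.sum_share_le hF hpaw (hmin v)
  have h4 : ∑ v, (30 * (G.degree v - 4) + 120) = ∑ v, 30 * G.degree v :=
    Finset.sum_congr rfl fun v _ => by have := hmin v; omega
  rw [Finset.sum_add_distrib, Finset.sum_const, smul_eq_mul, Finset.card_univ,
    ← Finset.mul_sum Finset.univ (fun v => G.degree v)] at h4
  have h5 := h.sum_degree_le
  rw [Fintype.card_sum] at hcard
  omega

end IsPlanarization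

end

/-- Every 1-planar graph with minimum degree 7 contains a copy of the paw
K₁ ∨ (K₁ ∪ K₂) (a triangle abc with a pendant edge ad) with all vertices of
degree at most 9. -/
theorem one_planar_light_paw {V : Type*} [Fintype V] [Nonempty V]
    (G : SimpleGraph V) [DecidableRel G.Adj] (h1p : G.IsOnePlanar)
    (hmin : ∀ v : V, 7 ≤ G.degree v) :
    ∃ a b c d : V, a ≠ b ∧ a ≠ c ∧ a ≠ d ∧ b ≠ c ∧ b ≠ d ∧ c ≠ d ∧
      G.Adj a b ∧ G.Adj a c ∧ G.Adj b c ∧ G.Adj a d ∧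
      G.degree a ≤ 9 ∧ G.degree b ≤ 9 ∧ G.degree c ≤ 9 ∧ G.degree d ≤ 9 := by
  classical
  obtain ⟨D⟩ := h1p
  have := D.finite_crossing
  have : Fintype D.Crossing := Fintype.ofFinite _
  obtain ⟨M⟩ := D.nonempty_gridModel fun v =>
    (G.degree_pos_iff_exists_adj v).1 (by have := hmin v; omega)
  obtain ⟨F, hclique, htwo, hcard⟩ := M.exists_triangles
  exact D.isPlanarization.hasLightPaw ⟨hclique, htwo⟩ hmin hcard
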